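/- Let C be a tilted algebra (C = End_A T for A hereditary and T a tilting A-module) and B = C ⋉ Ext^2_C(DC,C) the corresponding cluster-tilted algebra. Let M be an indecomposable τ_C-rigid C-module. Then M is τ_B-rigid if and only if Hom_C(τ_C^{-1}Ω_C^{-1}M, Gen M) = 0. -/

import Mathlib

open CategoryTheory MulOpposite

open CategoryTheory MulOpposite

/-! Core definitions: right `A`-modules are modules over `Aᵐᵒᵖ`. -/

/-- The category of (small) modules over a ring `R`.  For a `k`-algebra `A`,
right `A`-modules are `Mdl Aᵐᵒᵖ`. -/
abbrev Mdl (R : Type) [Ring R] := ModuleCat.{0} R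

section Generic

variable (R : Type) [Ring R]

/-- `f : P → M` is a projective cover: `P` projective, `f` surjective with
superfluous kernel. -/
def IsProjCover {P M : Mdl R} (f : P →ₗ[R] M) : Prop :=
  Module.Projective R P ∧ Function.Surjective f ∧
    ∀ N : Submodule R P, N ⊔ LinearMap.ker f = ⊤ → N = ⊤

/-- `f : M → I` is an injective envelope: `I` injective, `f` injective with
essential image. -/
def IsInjEnv {M I : Mdl R} (f : M →ₗ[R] I) : Prop :=
  Module.Injective R I ∧ Function.Injective f ∧
    ∀ K : Submodule R I, K ⊓ LinearMap.range f = ⊥ → K = ⊥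

/-- `Hom_R(X, Y) = 0`. -/
def HomZero (X Y : Mdl R) : Prop := ∀ f : X →ₗ[R] Y, f = 0

/-- `X ∈ Gen M`: `X` is an epimorphic image of a finite direct sum of copies of `M`. -/
def MemGen (M X : Mdl R) : Prop :=
  ∃ (d : ℕ) (f : (Fin d → M) →ₗ[R] X), Function.Surjective f

/-- `X ∈ add M`: `X` is a direct summand of a finite direct sum of copies of `M`. -/
def MemAdd (M X : Mdl R) : Prop :=
  ∃ (n : ℕ) (s : X →ₗ[R] (Fin n → M)) (r : (Fin n → M) →ₗ[R] X),
    r.comp s = LinearMap.id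

/-- projective dimension at most 1: a length-one projective resolution exists. -/
def PdLE1 (M : Mdl R) : Prop :=
  ∃ (P1 P0 : Mdl R) (d1 : P1 →ₗ[R] P0) (d0 : P0 →ₗ[R] M),
    Module.Projective R P1 ∧ Module.Projective R P0 ∧
    Function.Injective d1 ∧ Function.Surjective d0 ∧
    LinearMap.range d1 = LinearMap.ker d0

/-- projective dimension at most 2. -/
def PdLE2 (M : Mdl R) : Prop :=
  ∃ (P2 P1 P0 : Mdl R) (d2 : P2 →ₗ[R] P1) (d1 : P1 →ₗ[R] P0) (d0 : P0 →ₗ[R] M),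
    Module.Projective R P2 ∧ Module.Projective R P1 ∧ Module.Projective R P0 ∧
    Function.Injective d2 ∧ Function.Surjective d0 ∧
    LinearMap.range d2 = LinearMap.ker d1 ∧ LinearMap.range d1 = LinearMap.ker d0

/-- injective dimension at most 1. -/
def IdLE1 (M : Mdl R) : Prop :=
  ∃ (I0 I1 : Mdl R) (d0 : M →ₗ[R] I0) (d1 : I0 →ₗ[R] I1),
    Module.Injective R I0 ∧ Module.Injective R I1 ∧
    Function.Injective d0 ∧ Function.Surjective d1 ∧
    LinearMap.range d0 = LinearMap.ker d1

/-- global dimension at most 2 (every module has projective dimension ≤ 2). -/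
def GlDimLE2 : Prop := ∀ M : Mdl R, PdLE2 R M

/-- global dimension exactly 2. -/
def GlDimEq2 : Prop := GlDimLE2 R ∧ ¬ ∀ M : Mdl R, PdLE1 R M

/-- `W` is a first syzygy `Ω M` of `M` (kernel of a projective cover). -/
def IsSyzygy (M W : Mdl R) : Prop :=
  ∃ (P : Mdl R) (f : P →ₗ[R] M), IsProjCover R f ∧
    Nonempty (W ≃ₗ[R] LinearMap.ker f)

/-- `W` is a first cosyzygy `Ω⁻¹ M` of `M` (cokernel of an injective envelope). -/
def IsCosyzygy (M W : Mdl R) : Prop :=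
  ∃ (I : Mdl R) (f : M →ₗ[R] I), IsInjEnv R f ∧
    Nonempty (W ≃ₗ[R] (I ⧸ LinearMap.range f))

/-- `P1 --d1--> P0 --d0--> M → 0` is a minimal projective presentation. -/
def IsMinPres {P1 P0 M : Mdl R} (d1 : P1 →ₗ[R] P0) (d0 : P0 →ₗ[R] M) : Prop :=
  IsProjCover R d0 ∧ Module.Projective R P1 ∧
  LinearMap.range d1 = LinearMap.ker d0 ∧
  ∀ N : Submodule R P1, N ⊔ LinearMap.ker d1 = ⊤ → N = ⊤

/-- `Ext¹_R(X, Y) = 0`, expressed as: every short exact sequence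
`0 → Y → Z → X → 0` splits. -/
def Ext1Zero (X Y : Mdl R) : Prop :=
  ∀ (Z : Mdl R) (i : Y →ₗ[R] Z) (p : Z →ₗ[R] X),
    Function.Injective i → Function.Surjective p →
    LinearMap.range i = LinearMap.ker p →
    ∃ s : X →ₗ[R] Z, p.comp s = LinearMap.id

/-- partial tilting module: `pd ≤ 1` and `Ext¹(M,M) = 0`. -/
def PartialTilting (M : Mdl R) : Prop := PdLE1 R M ∧ Ext1Zero R M M

/-- tilting module: partial tilting plus a coresolution
`0 → R → T' → T'' → 0` with `T', T'' ∈ add M` of the regular module. -/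
def IsTilting (M : Mdl R) : Prop :=
  PartialTilting R M ∧
  ∃ (T' T'' : Mdl R) (i : ModuleCat.of R R →ₗ[R] T') (p : T' →ₗ[R] T''),
    MemAdd R M T' ∧ MemAdd R M T'' ∧
    Function.Injective i ∧ Function.Surjective p ∧
    LinearMap.range i = LinearMap.ker p

/-- an indecomposable (nonzero) module. -/
def Indecomp (M : Mdl R) : Prop :=
  Nontrivial M ∧ ∀ (U V : Submodule R M), IsCompl U V → U = ⊥ ∨ V = ⊥

/-- the number of isomorphism classes of simple `R`-modules is `n`. -/
def SimpleCount (n : ℕ) : Prop :=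
  ∃ S : Fin n → Mdl R,
    (∀ i, IsSimpleModule R (S i)) ∧
    (∀ i j, Nonempty ((S i) ≃ₗ[R] (S j)) → i = j) ∧
    ∀ X : Mdl R, IsSimpleModule R X → ∃ i, Nonempty (X ≃ₗ[R] S i)

end Generic

section Duality

variable (k : Type) [Field k] (A : Type) [Ring A] [Algebra k A]

/-- `N` (a right `A`-module) is the `k`-linear dual `D M` of the left `A`-module `M`:
witnessed by a nondegenerate balanced `k`-bilinear pairing. -/
def IskDual (N : Mdl Aᵐᵒᵖ) (M : Mdl A) : Prop :=
  ∃ φ : N → M → k,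
    (∀ n n' m, φ (n + n') m = φ n m + φ n' m) ∧
    (∀ n m m', φ n (m + m') = φ n m + φ n m') ∧
    (∀ (c : k) n m, φ n ((algebraMap k A c) • m) = c * φ n m) ∧
    (∀ (a : A) n m, φ (op a • n) m = φ n (a • m)) ∧
    (∀ n, (∀ m, φ n m = 0) → n = 0) ∧
    (∀ m, (∀ n, φ n m = 0) → m = 0)

/-- `T = τ M`: the Auslander–Reiten translate of the right `A`-module `M`,
i.e. the `k`-dual of the transpose `Tr M` computed from a minimal projective
presentation. -/
def IsTau (M T : Mdl Aᵐᵒᵖ) : Prop :=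
  ∃ (P1 P0 : Mdl Aᵐᵒᵖ) (d1 : P1 →ₗ[Aᵐᵒᵖ] P0) (d0 : P0 →ₗ[Aᵐᵒᵖ] M),
    IsMinPres Aᵐᵒᵖ d1 d0 ∧
    ∃ (Tr : Mdl A) (q : (P1 →ₗ[Aᵐᵒᵖ] A) →ₗ[A] Tr),
      Function.Surjective q ∧
      (∀ g : P1 →ₗ[Aᵐᵒᵖ] A, q g = 0 ↔ ∃ f : P0 →ₗ[Aᵐᵒᵖ] A, g = f.comp d1) ∧
      IskDual k A T Tr

/-- `T = τ⁻¹ M`: the inverse Auslander–Reiten translate, `Tr (D M)`, computed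
from a minimal projective presentation of the left module `D M`. -/
def IsTauInv (M T : Mdl Aᵐᵒᵖ) : Prop :=
  ∃ (DM : Mdl A), IskDual k A M DM ∧
  ∃ (Q1 Q0 : Mdl A) (d1 : Q1 →ₗ[A] Q0) (d0 : Q0 →ₗ[A] DM),
    IsMinPres A d1 d0 ∧
    ∃ q : (Q1 →ₗ[A] A) →ₗ[Aᵐᵒᵖ] T,
      Function.Surjective q ∧
      ∀ g : Q1 →ₗ[A] A, q g = 0 ↔ ∃ f : Q0 →ₗ[A] A, g = f.comp d1

/-- `W = τ⁻¹ Ω⁻¹ M`. -/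
def IsTauInvCosyz (M W : Mdl Aᵐᵒᵖ) : Prop :=
  ∃ V, IsCosyzygy Aᵐᵒᵖ M V ∧ IsTauInv k A V W

/-- `W = τ Ω M`. -/
def IsTauSyz (M W : Mdl Aᵐᵒᵖ) : Prop :=
  ∃ V, IsSyzygy Aᵐᵒᵖ M V ∧ IsTau k A V W

/-- `M` is `τ`-rigid: `Hom(M, τM) = 0`. -/
def TauRigid (M : Mdl Aᵐᵒᵖ) : Prop :=
  ∀ T, IsTau k A M T → HomZero Aᵐᵒᵖ M T

/-- `M` is `τ`-tilting: `τ`-rigid with as many pairwise nonisomorphic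
indecomposable summands as there are simple modules. -/
def TauTilting (M : Mdl Aᵐᵒᵖ) : Prop :=
  TauRigid k A M ∧
  ∃ (n : ℕ) (N : Fin n → Mdl Aᵐᵒᵖ),
    (∀ i, Indecomp Aᵐᵒᵖ (N i)) ∧
    (∀ i j, Nonempty ((N i) ≃ₗ[Aᵐᵒᵖ] (N j)) → i = j) ∧
    Nonempty (M ≃ₗ[Aᵐᵒᵖ] ((i : Fin n) → N i)) ∧
    SimpleCount Aᵐᵒᵖ n

end Duality


section SplitExt

variable {B C : Type} [Ring B] [Ring C]

/-- a right `C`-module viewed as a right `B`-module via a ring hom `π : B → C`. -/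
def modAlong (π : B →+* C) (M : Mdl Cᵐᵒᵖ) : Mdl Bᵐᵒᵖ :=
  letI : Module Bᵐᵒᵖ M := Module.compHom M (RingHom.op π)
  ModuleCat.of _ M

/-- `X` is the induced module `M ⊗_C B` along `σ : C → B`, characterized by the
universal property of induction (extension of scalars). -/
def IsInducedAlong (σ : C →+* B) (M : Mdl Cᵐᵒᵖ) (X : Mdl Bᵐᵒᵖ) : Prop :=
  ∃ φ : M →+ X,
    (∀ (c : C) (m : M), φ (op c • m) = op (σ c) • φ m) ∧
    ∀ (Y : Mdl Bᵐᵒᵖ) (ψ : M →+ Y),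
      (∀ (c : C) (m : M), ψ (op c • m) = op (σ c) • ψ m) →
      ∃! h : X →ₗ[Bᵐᵒᵖ] Y, ∀ m, h (φ m) = ψ m

/-- `X` is the coinduced module `D(B ⊗_C D M) ≅ Hom_C(B, M)` along `σ : C → B`,
characterized by the universal property of coinduction. -/
def IsCoinducedAlong (σ : C →+* B) (M : Mdl Cᵐᵒᵖ) (X : Mdl Bᵐᵒᵖ) : Prop :=
  ∃ p : X →+ M,
    (∀ (c : C) (x : X), p (op (σ c) • x) = op c • p x) ∧
    ∀ (Y : Mdl Bᵐᵒᵖ) (ψ : Y →+ M),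
      (∀ (c : C) (y : Y), ψ (op (σ c) • y) = op c • ψ y) →
      ∃! h : Y →ₗ[Bᵐᵒᵖ] X, ∀ y, p (h y) = ψ y

end SplitExt

section TrivExt

variable (C : Type) [Ring C] (E : Type) [AddCommGroup E]
  [Module C E] [Module Cᵐᵒᵖ E] [SMulCommClass C Cᵐᵒᵖ E]

/-- the projection `B = C ⋉ E → C` as a ring hom. -/
def tszeFst : TrivSqZeroExt C E →+* C where
  toFun := TrivSqZeroExt.fst
  map_one' := rfl
  map_mul' _ _ := rfl
  map_zero' := rfl
  map_add' _ _ := rfl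

/-- the inclusion `σ : C → B = C ⋉ E` as a ring hom. -/
def tszeInl : C →+* TrivSqZeroExt C E where
  toFun := TrivSqZeroExt.inl
  map_one' := rfl
  map_mul' x y := TrivSqZeroExt.inl_mul (M := E) x y
  map_zero' := TrivSqZeroExt.inl_zero (M := E)
  map_add' x y := TrivSqZeroExt.inl_add (M := E) x y

/-- a right `C`-module viewed as a module over the trivial extension `C ⋉ E`. -/
def modB (M : Mdl Cᵐᵒᵖ) : Mdl (TrivSqZeroExt C E)ᵐᵒᵖ :=
  modAlong (tszeFst C E) M

/-- `X = M ⊗_C B` for `B = C ⋉ E`. -/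
def IsInduced (M : Mdl Cᵐᵒᵖ) (X : Mdl (TrivSqZeroExt C E)ᵐᵒᵖ) : Prop :=
  IsInducedAlong (tszeInl C E) M X

/-- `X = D(B ⊗_C D M)` for `B = C ⋉ E`. -/
def IsCoinduced (M : Mdl Cᵐᵒᵖ) (X : Mdl (TrivSqZeroExt C E)ᵐᵒᵖ) : Prop :=
  IsCoinducedAlong (tszeInl C E) M X

end TrivExt

section RelExt

variable (k : Type) [Field k] (C : Type) [Ring C] [Algebra k C]
  (E : Type) [AddCommGroup E] [Module C E] [Module Cᵐᵒᵖ E]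

/-- The `C`-`C`-bimodule `E` is `Ext²_C(DC, C)`: there is a projective
resolution `0 → P2 → P1 → P0 → DC → 0` of the right module `DC = Hom_k(C,k)`
(characterized by a nondegenerate balanced pairing `φ` with `C`), and `E` is
the cokernel of `Hom_C(P1, C) → Hom_C(P2, C)` as a left `C`-module, with the
right `C`-action on `E` induced (contravariantly, via lifts of the left action
on `DC`) by functoriality of `Ext²(-, C)`. -/
def IsRelExt : Prop :=
  ∃ (DC : Mdl Cᵐᵒᵖ) (φ : DC → C → k),
    (∀ n n' m, φ (n + n') m = φ n m + φ n' m) ∧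
    (∀ n m m', φ n (m + m') = φ n m + φ n m') ∧
    (∀ (c : k) n m, φ n ((algebraMap k C c) * m) = c * φ n m) ∧
    (∀ (a : C) n m, φ (op a • n) m = φ n (a * m)) ∧
    (∀ n, (∀ m, φ n m = 0) → n = 0) ∧
    (∀ m, (∀ n, φ n m = 0) → m = 0) ∧
    ∃ (P2 P1 P0 : Mdl Cᵐᵒᵖ) (d2 : P2 →ₗ[Cᵐᵒᵖ] P1) (d1 : P1 →ₗ[Cᵐᵒᵖ] P0)
      (d0 : P0 →ₗ[Cᵐᵒᵖ] DC),
      Module.Projective Cᵐᵒᵖ P2 ∧ Module.Projective Cᵐᵒᵖ P1 ∧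
      Module.Projective Cᵐᵒᵖ P0 ∧
      Function.Injective d2 ∧ Function.Surjective d0 ∧
      LinearMap.range d2 = LinearMap.ker d1 ∧
      LinearMap.range d1 = LinearMap.ker d0 ∧
      ∃ q : (P2 →ₗ[Cᵐᵒᵖ] C) →ₗ[C] E,
        Function.Surjective q ∧
        (∀ g : P2 →ₗ[Cᵐᵒᵖ] C, q g = 0 ↔ ∃ f : P1 →ₗ[Cᵐᵒᵖ] C, g = f.comp d2) ∧
        ∀ c : C, ∃ (μ : DC →ₗ[Cᵐᵒᵖ] DC) (f0 : P0 →ₗ[Cᵐᵒᵖ] P0)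
            (f1 : P1 →ₗ[Cᵐᵒᵖ] P1) (f2 : P2 →ₗ[Cᵐᵒᵖ] P2),
          (∀ n x, φ (μ n) x = φ n (x * c)) ∧
          d0.comp f0 = μ.comp d0 ∧
          d1.comp f1 = f0.comp d1 ∧
          d2.comp f2 = f1.comp d2 ∧
          ∀ g : P2 →ₗ[Cᵐᵒᵖ] C, q (g.comp f2) = op c • q g

end RelExt


open CategoryTheory MulOpposite

section Basics
variable {R : Type} [Ring R]

lemma factor_inj {A Y Z : Type} [AddCommGroup A] [AddCommGroup Y] [AddCommGroup Z]
    [Module R A] [Module R Y] [Module R Z] (f : A →ₗ[R] Z) (i : Y →ₗ[R] Z)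
    (hi : Function.Injective i) (h : ∀ a, ∃ y, i y = f a) :
    ∃ g : A →ₗ[R] Y, ∀ a, i (g a) = f a := by
  choose g hg using h
  exact ⟨{ toFun := g
           map_add' := fun a b => hi (by simp [hg])
           map_smul' := fun r a => hi (by simp [hg]) }, hg⟩

lemma factor_surj {P X Z : Type} [AddCommGroup P] [AddCommGroup X] [AddCommGroup Z]
    [Module R P] [Module R X] [Module R Z] (f : P →ₗ[R] Z) (p : P →ₗ[R] X)
    (hp : Function.Surjective p) (h : ∀ a, p a = 0 → f a = 0) :
    ∃ g : X →ₗ[R] Z, ∀ a, g (p a) = f a := by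
  have key : ∀ a b, p a = p b → f a = f b := fun a b hab => by
    have := h (a - b) (by simp [hab])
    rwa [map_sub, sub_eq_zero] at this
  choose s hs using hp
  exact ⟨{ toFun := fun x => f (s x)
           map_add' := fun a b => by
             rw [← map_add]; apply key; simp [hs]
           map_smul' := fun r a => by
             rw [RingHom.id_apply, ← map_smul]; apply key; simp [hs] },
    fun a => key _ _ (hs _)⟩

lemma proj_lift {P X Z : Type} [AddCommGroup P] [AddCommGroup X] [AddCommGroup Z]
    [Module R P] [Module R X] [Module R Z] (hP : Module.Projective R P)
    (f : Z →ₗ[R] X) (hf : Function.Surjective f) (g : P →ₗ[R] X) :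
    ∃ h : P →ₗ[R] Z, ∀ a, f (h a) = g a := by
  obtain ⟨h, hh⟩ := Module.projective_lifting_property f g hf
  exact ⟨h, fun a => LinearMap.congr_fun hh a⟩

/-- lifting into the image of a map -/
lemma proj_lift' {P X Z : Type} [AddCommGroup P] [AddCommGroup X] [AddCommGroup Z]
    [Module R P] [Module R X] [Module R Z] (hP : Module.Projective R P)
    (f : Z →ₗ[R] X) (g : P →ₗ[R] X) (h : ∀ a, ∃ z, f z = g a) :
    ∃ h : P →ₗ[R] Z, ∀ a, f (h a) = g a := by
  obtain ⟨h, hh⟩ := proj_lift hP f.rangeRestrict f.surjective_rangeRestrict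
    (g.codRestrict (LinearMap.range f) (fun a => h a))
  exact ⟨h, fun a => congrArg Subtype.val (hh a)⟩

lemma inj_ext {K P I : Type} [AddCommGroup K] [AddCommGroup P] [AddCommGroup I]
    [Module R K] [Module R P] [Module R I] (hI : Module.Injective R I)
    (i : K →ₗ[R] P) (hi : Function.Injective i) (g : K →ₗ[R] I) :
    ∃ h : P →ₗ[R] I, ∀ a, h (i a) = g a := hI.out i hi g

/-- extension along a non injective map -/
lemma inj_ext' {K P I : Type} [AddCommGroup K] [AddCommGroup P] [AddCommGroup I]
    [Module R K] [Module R P] [Module R I] (hI : Module.Injective R I)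
    (i : K →ₗ[R] P) (g : K →ₗ[R] I) (h : ∀ a, i a = 0 → g a = 0) :
    ∃ h : P →ₗ[R] I, ∀ a, h (i a) = g a := by
  obtain ⟨g', hg'⟩ := factor_surj g i.rangeRestrict i.surjective_rangeRestrict
    (fun a ha => h a (congrArg Subtype.val ha))
  obtain ⟨h, hh⟩ := inj_ext hI (LinearMap.range i).subtype Subtype.val_injective g'
  exact ⟨h, fun a => by rw [← hg']; exact hh (i.rangeRestrict a)⟩

lemma ext1_extend {X Y : Mdl R} (h : Ext1Zero R X Y) {K P : Type} [AddCommGroup K]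
    [AddCommGroup P] [Module R K] [Module R P] (i : K →ₗ[R] P) (p : P →ₗ[R] X)
    (hi : Function.Injective i) (hp : Function.Surjective p)
    (he : LinearMap.range i = LinearMap.ker p) (g : K →ₗ[R] Y) :
    ∃ g' : P →ₗ[R] Y, ∀ a, g' (i a) = g a := by
  let S : Submodule R (Y × P) := LinearMap.range (g.prod (-i))
  let iZ : Y →ₗ[R] ((Y × P) ⧸ S) := S.mkQ ∘ₗ LinearMap.inl R Y P
  let pZ : ((Y × P) ⧸ S) →ₗ[R] X := S.liftQ (p ∘ₗ LinearMap.snd R Y P) (by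
    rintro _ ⟨k, rfl⟩
    have : i k ∈ LinearMap.ker p := he ▸ ⟨k, rfl⟩
    simpa using this)
  have hiZ : Function.Injective iZ := by
    rw [← LinearMap.ker_eq_bot, LinearMap.ker_eq_bot']
    intro y hy
    have : (y, (0 : P)) ∈ S := (Submodule.Quotient.mk_eq_zero S).1 hy
    obtain ⟨k, hk⟩ := this
    have h1 : g k = y := congrArg Prod.fst hk
    have h2 : -i k = 0 := congrArg Prod.snd hk
    have h3 : k = 0 := hi (by simpa using h2)
    rw [← h1, h3, map_zero]
  have hpZ : Function.Surjective pZ := fun x => by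
    obtain ⟨a, rfl⟩ := hp x
    exact ⟨S.mkQ (0, a), rfl⟩
  have hker : ∀ z, pZ z = 0 → ∃ y, iZ y = z := by
    intro z
    obtain ⟨⟨y, a⟩, rfl⟩ := S.mkQ_surjective z
    intro hz
    have ha : a ∈ LinearMap.range i := he ▸ (show p a = 0 from hz)
    obtain ⟨k, rfl⟩ := ha
    refine ⟨y + g k, ?_⟩
    refine (Submodule.Quotient.eq S).2 ⟨k, ?_⟩
    ext <;> simp
  have hcomp : ∀ y, pZ (iZ y) = 0 := fun y => by
    show p 0 = 0
    simp
  obtain ⟨s, hs⟩ := h (ModuleCat.of R ((Y × P) ⧸ S)) iZ pZ hiZ hpZ (by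
    ext z
    exact ⟨fun ⟨y, hy⟩ => hy ▸ hcomp y, fun hz => hker z hz⟩)
  obtain ⟨t, ht⟩ := factor_inj (S.mkQ ∘ₗ LinearMap.inr R Y P - s ∘ₗ p) iZ hiZ (fun a => hker _ (by
    have : pZ (s (p a)) = p a := LinearMap.congr_fun hs (p a)
    rw [LinearMap.sub_apply, map_sub, LinearMap.comp_apply s p, this]
    show p a - p a = 0
    simp))
  refine ⟨t, fun k => hiZ ?_⟩
  rw [ht]
  have h0 : p (i k) = 0 := (he ▸ ⟨k, rfl⟩ : i k ∈ LinearMap.ker p)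
  simp only [LinearMap.sub_apply, LinearMap.comp_apply, h0, map_zero, sub_zero]
  refine ((Submodule.Quotient.eq S).2 ⟨-k, ?_⟩)
  ext <;> simp

lemma ext1_of_extend {X Y : Mdl R} {K P : Type} [AddCommGroup K]
    [AddCommGroup P] [Module R K] [Module R P] (hP : Module.Projective R P)
    (i : K →ₗ[R] P) (p : P →ₗ[R] X) (hp : Function.Surjective p)
    (he : LinearMap.range i = LinearMap.ker p)
    (h : ∀ g : K →ₗ[R] Y, ∃ g' : P →ₗ[R] Y, ∀ a, g' (i a) = g a) : Ext1Zero R X Y := by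
  intro Z iY pZ hiY hpZ heZ
  obtain ⟨l, hl⟩ := proj_lift hP pZ hpZ p
  obtain ⟨g, hg⟩ := factor_inj (l ∘ₗ i) iY hiY (fun k => by
    have : l (i k) ∈ LinearMap.ker pZ := by
      rw [LinearMap.mem_ker, hl]
      exact (he ▸ ⟨k, rfl⟩ : i k ∈ LinearMap.ker p)
    rw [← heZ] at this
    exact this)
  obtain ⟨g', hg'⟩ := h g
  obtain ⟨s, hs⟩ := factor_surj (l - iY ∘ₗ g') p hp (fun a ha => by
    have : a ∈ LinearMap.range i := he ▸ ha
    obtain ⟨k, rfl⟩ := this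
    simp [hg', hg])
  refine ⟨s, ?_⟩
  ext x
  obtain ⟨a, rfl⟩ := hp x
  have : pZ (iY (g' a)) = 0 := (heZ ▸ ⟨_, rfl⟩ : iY (g' a) ∈ LinearMap.ker pZ)
  simp [hs, hl, this]

lemma surj_of_ext {P1 P0 M : Mdl R} [IsArtinian R M] {d1 : P1 →ₗ[R] P0} {d0 : P0 →ₗ[R] M}
    (hpres : IsMinPres R d1 d0) (hE : ∀ X, MemGen R M X → Ext1Zero R M X) :
    ∀ u : P1 →ₗ[R] M, ∃ v : P0 →ₗ[R] M, ∀ x, u x = v (d1 x) := by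
  obtain ⟨⟨hP0, hd0, -⟩, hP1, hex, hmin⟩ := hpres
  suffices H : ∀ N : Submodule R M, ∀ u : P1 →ₗ[R] M, LinearMap.range u = N →
      ∃ v : P0 →ₗ[R] M, ∀ x, u x = v (d1 x) from fun u => H _ u rfl
  intro N
  induction N using WellFoundedLT.induction with
  | ind N ih =>
  intro u hu
  let L := (LinearMap.ker d1).map u
  have hL : L ≤ LinearMap.range u := LinearMap.map_le_range
  by_cases hLu : L = LinearMap.range u
  · have : LinearMap.ker u = ⊤ := by
      apply hmin
      rw [eq_top_iff]
      rintro x -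
      have : u x ∈ L := hLu ▸ ⟨x, rfl⟩
      obtain ⟨y, hy, hyx⟩ := this
      rw [Submodule.mem_sup]
      exact ⟨x - y, by simp [hyx], y, hy, by simp⟩
    exact ⟨0, fun x => by
      have : x ∈ LinearMap.ker u := this ▸ trivial
      simpa using this⟩
  · obtain ⟨g, hg⟩ := factor_surj (L.mkQ ∘ₗ u)
      (d1.codRestrict (LinearMap.ker d0) (fun x => hex ▸ ⟨x, rfl⟩)) (by
        rintro ⟨y, hy⟩
        rw [← hex] at hy
        obtain ⟨x, rfl⟩ := hy
        exact ⟨x, rfl⟩) (fun x hx => by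
        have hx : d1 x = 0 := congrArg Subtype.val hx
        exact (Submodule.Quotient.mk_eq_zero L).2 ⟨x, hx, rfl⟩)
    have hgen : MemGen R M (ModuleCat.of R (M ⧸ L)) :=
      ⟨1, L.mkQ ∘ₗ LinearMap.proj 0, fun y => by
        obtain ⟨m, rfl⟩ := L.mkQ_surjective y
        exact ⟨fun _ => m, rfl⟩⟩
    obtain ⟨v, hv⟩ := ext1_extend (hE _ hgen) (LinearMap.ker d0).subtype d0 Subtype.val_injective
      hd0 (by simp) g
    obtain ⟨v', hv'⟩ := proj_lift hP0 L.mkQ L.mkQ_surjective v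
    have hw : LinearMap.range (u - v' ∘ₗ d1) ≤ L := by
      rintro _ ⟨x, rfl⟩
      rw [← Submodule.Quotient.mk_eq_zero L]
      have h1 := hv' (d1 x)
      have h2 := hv (d1.codRestrict (LinearMap.ker d0) (fun x => hex ▸ ⟨x, rfl⟩) x)
      rw [hg] at h2
      have h3 : v (d1 x) = L.mkQ (u x) := h2
      rw [h3] at h1
      show L.mkQ (u x - v' (d1 x)) = 0
      rw [map_sub, h1, sub_self]
    obtain ⟨w, hw'⟩ := ih _ (hu ▸ lt_of_le_of_lt hw (lt_of_le_of_ne hL hLu)) _ rfl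
    refine ⟨w + v', fun x => ?_⟩
    have := hw' x
    simp only [LinearMap.sub_apply, LinearMap.comp_apply] at this
    rw [LinearMap.add_apply, ← this]; simp

lemma ext_of_surj {P1 P0 M : Mdl R} {d1 : P1 →ₗ[R] P0} {d0 : P0 →ₗ[R] M}
    (hpres : IsMinPres R d1 d0)
    (h : ∀ u : P1 →ₗ[R] M, ∃ v : P0 →ₗ[R] M, ∀ x, u x = v (d1 x)) :
    ∀ X, MemGen R M X → Ext1Zero R M X := by
  obtain ⟨⟨hP0, hd0, -⟩, hP1, hex, hmin⟩ := hpres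
  rintro X ⟨d, f, hf⟩
  refine ext1_of_extend hP0 (LinearMap.ker d0).subtype d0 hd0 (by simp) (fun g => ?_)
  obtain ⟨u, hu⟩ := proj_lift hP1 f hf
    (g ∘ₗ (d1.codRestrict (LinearMap.ker d0) (fun x => hex ▸ ⟨x, rfl⟩)))
  choose v hv using fun j => h (LinearMap.proj j ∘ₗ u)
  refine ⟨f ∘ₗ LinearMap.pi v, ?_⟩
  rintro ⟨y, hy⟩
  have hy' := hy
  rw [← hex] at hy'
  obtain ⟨x, rfl⟩ := hy'
  have h1 : LinearMap.pi v (d1 x) = u x := by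
    ext j; exact (hv j x).symm
  show f (LinearMap.pi v (d1 x)) = _
  rw [h1, hu]
  rfl

end Basics

open CategoryTheory MulOpposite

section Covers
variable {R : Type} [Ring R]

lemma finite_of_superfluous {P M : Type} [AddCommGroup P] [AddCommGroup M] [Module R P]
    [Module R M] (f : P →ₗ[R] M) (h : ∀ N : Submodule R P, N ⊔ LinearMap.ker f = ⊤ → N = ⊤)
    (hfg : (LinearMap.range f).FG) : Module.Finite R P := by
  obtain ⟨S, hS⟩ := hfg
  have hl : ∀ y ∈ S, ∃ x, f x = y := fun y hy => by
    have : y ∈ LinearMap.range f := hS ▸ Submodule.subset_span hy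
    exact this
  choose! g hg using hl
  classical
  refine ⟨⟨S.image g, h _ ?_⟩⟩
  rw [eq_top_iff]
  rintro x -
  have hx : f x ∈ Submodule.span R (S : Set M) := hS ▸ ⟨x, rfl⟩
  have : Submodule.span R (S : Set M) ≤ (Submodule.span R (S.image g : Set P)).map f := by
    rw [Submodule.span_le]
    intro y hy
    exact ⟨g y, Submodule.subset_span (by simpa using ⟨y, hy, rfl⟩), hg y hy⟩
  obtain ⟨z, hz, hzx⟩ := this hx
  rw [Submodule.mem_sup]
  exact ⟨z, hz, x - z, by simp [hzx], by simp⟩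

lemma exists_projCover [IsArtinianRing R] (M : Mdl R) [Module.Finite R M] :
    ∃ (P : Mdl R) (f : P →ₗ[R] M), IsProjCover R f ∧ Module.Finite R P := by
  obtain ⟨n, f, hf⟩ := Module.Finite.exists_fin' R M
  obtain ⟨N, hN, hmin⟩ := exists_minimal_of_wellFoundedLT
    (fun N : Submodule R (Fin n → R) => Module.Projective R N ∧ N.map f = ⊤)
    ⟨⊤, Module.Projective.of_equiv Submodule.topEquiv.symm, by
      rw [Submodule.map_top, LinearMap.range_eq_top]; exact hf⟩
  obtain ⟨hNp, hNs⟩ := hN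
  let f' : N →ₗ[R] M := f.domRestrict N
  have hf' : Function.Surjective f' := fun m => by
    have : m ∈ N.map f := hNs ▸ trivial
    obtain ⟨x, hx, rfl⟩ := this
    exact ⟨⟨x, hx⟩, rfl⟩
  suffices H : ∀ N' : Submodule R N, N' ⊔ LinearMap.ker f' = ⊤ → N' = ⊤ from
    ⟨ModuleCat.of R N, f', ⟨hNp, hf', H⟩, inferInstanceAs (Module.Finite R N)⟩
  intro N' hN'
  let f'' : N' →ₗ[R] M := f' ∘ₗ N'.subtype
  have hs : Function.Surjective f'' := fun m => by
    obtain ⟨x, rfl⟩ := hf' m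
    have : x ∈ N' ⊔ LinearMap.ker f' := hN' ▸ trivial
    obtain ⟨y, hy, z, hz, rfl⟩ := Submodule.mem_sup.1 this
    refine ⟨⟨y, hy⟩, ?_⟩
    rw [map_add, LinearMap.mem_ker.1 hz, add_zero]
    rfl
  obtain ⟨g, hg⟩ := proj_lift (R := R) (P := N) (X := M) (Z := N') hNp f'' hs f'
  let G : Module.End R N := N'.subtype ∘ₗ g
  have hG : ∀ x, f' (G x) = f' x := hg
  obtain ⟨k, hk⟩ := Filter.eventually_atTop.1 G.eventually_isCompl_ker_pow_range_pow
  have hc := hk (k + 1) (Nat.le_succ k)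
  have hGk : ∀ j x, f' ((G ^ j) x) = f' x := by
    intro j
    induction j with
    | zero => intro x; rfl
    | succ j ih => intro x; rw [pow_succ, Module.End.mul_apply, ih, hG]
  let N2 := (LinearMap.range (G ^ (k+1))).map N.subtype
  have hproj : Module.Projective R (LinearMap.range (G ^ (k+1))) := by
    refine Module.Projective.of_split (M := N) (Submodule.subtype _)
      (Submodule.projectionOnto _ _ hc.symm) ?_
    ext x
    simp
  have hproj2 : Module.Projective R N2 := by
    exact Module.Projective.of_equiv (Submodule.equivMapOfInjective N.subtype
      Subtype.val_injective (LinearMap.range (G ^ (k+1))))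
  have hle : N ≤ N2 := hmin ⟨hproj2, by
    rw [eq_top_iff]
    rintro m -
    obtain ⟨x, rfl⟩ := hf' m
    exact ⟨((G ^ (k+1)) x : N), ⟨_, ⟨x, rfl⟩, rfl⟩, hGk _ _⟩⟩ (Submodule.map_subtype_le _ _)
  rw [eq_top_iff]
  rintro x -
  obtain ⟨y, ⟨z, rfl⟩, hy⟩ := hle x.2
  have : (G ^ (k+1)) z = x := Subtype.ext hy
  rw [← this, pow_succ', Module.End.mul_apply]
  exact (g _).2

lemma exists_minPres [IsArtinianRing R] (M : Mdl R) [Module.Finite R M] :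
    ∃ (P1 P0 : Mdl R) (d1 : P1 →ₗ[R] P0) (d0 : P0 →ₗ[R] M), IsMinPres R d1 d0 := by
  obtain ⟨P0, d0, h0, hfin⟩ := exists_projCover M
  obtain ⟨P1, d, h1, -⟩ := exists_projCover (ModuleCat.of R (LinearMap.ker d0))
  have hker : LinearMap.ker ((LinearMap.ker d0).subtype ∘ₗ d) = LinearMap.ker d := by
    ext x; simp
  refine ⟨P1, P0, (LinearMap.ker d0).subtype ∘ₗ d, d0, h0, h1.1, ?_, ?_⟩
  · rw [LinearMap.range_comp, LinearMap.range_eq_top.2 h1.2.1]; simp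
  · rw [hker]; exact h1.2.2

lemma IsMinPres.finite [IsNoetherianRing R] {P1 P0 M : Mdl R} [Module.Finite R M]
    {d1 : P1 →ₗ[R] P0} {d0 : P0 →ₗ[R] M}
    (h : IsMinPres R d1 d0) : Module.Finite R P0 ∧ Module.Finite R P1 := by
  have h0 : Module.Finite R P0 := finite_of_superfluous d0 h.1.2.2 (by
    rw [LinearMap.range_eq_top.2 h.1.2.1]; exact Module.Finite.fg_top)
  refine ⟨h0, finite_of_superfluous d1 h.2.2.2 (IsNoetherian.noetherian _)⟩

end Covers

open CategoryTheory MulOpposite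

section KDual

/-- the `k`-structure on a module over a `k`-algebra -/
abbrev kmod (k R : Type) [Field k] [Ring R] [Algebra k R] (M : Type) [AddCommGroup M]
    [Module R M] : Module k M := Module.compHom M (algebraMap k R)

lemma kmod_tower (k R : Type) [Field k] [Ring R] [Algebra k R] (M : Type) [AddCommGroup M]
    [Module R M] : letI := kmod k R M; IsScalarTower k R M := by
  let := kmod k R M
  exact ⟨fun c r m => by
    rw [Algebra.smul_def, mul_smul]; rfl⟩

/-- `k`-dual -/
def KD (k Q : Type) [Field k] [AddCommGroup Q] [Module k Q] : Type := Q →ₗ[k] k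

namespace KD
variable {k Q : Type} [Field k] [AddCommGroup Q] [Module k Q]

instance : AddCommGroup (KD k Q) := inferInstanceAs (AddCommGroup (Q →ₗ[k] k))
instance : FunLike (KD k Q) Q k := inferInstanceAs (FunLike (Q →ₗ[k] k) Q k)
instance : LinearMapClass (KD k Q) k Q k := inferInstanceAs (LinearMapClass (Q →ₗ[k] k) k Q k)
instance : Module k (KD k Q) := inferInstanceAs (Module k (Q →ₗ[k] k))
instance [FiniteDimensional k Q] : FiniteDimensional k (KD k Q) :=
  inferInstanceAs (FiniteDimensional k (Q →ₗ[k] k))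

@[simp] lemma add_ap (ξ η : KD k Q) (x : Q) : (ξ + η) x = ξ x + η x := rfl
@[simp] lemma sub_ap (ξ η : KD k Q) (x : Q) : (ξ - η) x = ξ x - η x := rfl
@[simp] lemma zero_ap (x : Q) : (0 : KD k Q) x = 0 := rfl
@[simp] lemma ksmul_ap (c : k) (ξ : KD k Q) (x : Q) : (c • ξ) x = c * ξ x := rfl
@[ext] lemma ext' {ξ η : KD k Q} (h : ∀ x, ξ x = η x) : ξ = η := LinearMap.ext h

variable {C : Type} [Ring C] [Algebra k C] [Module C Q] [IsScalarTower k C Q]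

instance : Module Cᵐᵒᵖ (KD k Q) where
  smul a ξ := LinearMap.comp (ξ : Q →ₗ[k] k) (Algebra.lsmul k k Q (unop a))
  one_smul ξ := by
    apply LinearMap.ext; intro x
    show (ξ : Q →ₗ[k] k) ((1 : C) • x) = ξ x
    rw [one_smul]
  mul_smul a b ξ := by
    apply LinearMap.ext; intro x
    show (ξ : Q →ₗ[k] k) ((unop b * unop a) • x) = (ξ : Q →ₗ[k] k) (unop b • unop a • x)
    rw [mul_smul]
  smul_zero a := by apply LinearMap.ext; intro x; rfl
  zero_smul ξ := by
    apply LinearMap.ext; intro x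
    show (ξ : Q →ₗ[k] k) ((0 : C) • x) = 0
    rw [zero_smul, map_zero]
  smul_add a ξ η := by apply LinearMap.ext; intro x; rfl
  add_smul a b ξ := by
    apply LinearMap.ext; intro x
    show (ξ : Q →ₗ[k] k) ((unop a + unop b) • x) =
      (ξ : Q →ₗ[k] k) (unop a • x) + (ξ : Q →ₗ[k] k) (unop b • x)
    rw [add_smul, map_add]

@[simp] lemma op_smul_ap (a : C) (ξ : KD k Q) (x : Q) : (op a • ξ) x = ξ (a • x) := rfl

instance : IsScalarTower k Cᵐᵒᵖ (KD k Q) := ⟨fun c a ξ => by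
  ext x
  show ξ (unop (c • a) • x) = c * ξ (unop a • x)
  rw [unop_smul, smul_assoc, map_smul]; rfl⟩

end KD

/-- `k`-dual of a right module -/
def KD' (k Q : Type) [Field k] [AddCommGroup Q] [Module k Q] : Type := Q →ₗ[k] k

namespace KD'
variable {k Q : Type} [Field k] [AddCommGroup Q] [Module k Q]

instance : AddCommGroup (KD' k Q) := inferInstanceAs (AddCommGroup (Q →ₗ[k] k))
instance : FunLike (KD' k Q) Q k := inferInstanceAs (FunLike (Q →ₗ[k] k) Q k)
instance : LinearMapClass (KD' k Q) k Q k := inferInstanceAs (LinearMapClass (Q →ₗ[k] k) k Q k)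

@[simp] lemma add_ap (ξ η : KD' k Q) (x : Q) : (ξ + η) x = ξ x + η x := rfl
@[simp] lemma zero_ap (x : Q) : (0 : KD' k Q) x = 0 := rfl
@[ext] lemma ext' {ξ η : KD' k Q} (h : ∀ x, ξ x = η x) : ξ = η := LinearMap.ext h

variable {C : Type} [Ring C] [Algebra k C] [Module Cᵐᵒᵖ Q] [IsScalarTower k Cᵐᵒᵖ Q]

instance : Module C (KD' k Q) where
  smul a ξ := LinearMap.comp (ξ : Q →ₗ[k] k) (Algebra.lsmul k k Q (op a))
  one_smul ξ := by
    apply LinearMap.ext; intro x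
    show (ξ : Q →ₗ[k] k) ((1 : Cᵐᵒᵖ) • x) = ξ x
    rw [one_smul]
  mul_smul a b ξ := by
    apply LinearMap.ext; intro x
    show (ξ : Q →ₗ[k] k) ((op b * op a) • x) = (ξ : Q →ₗ[k] k) (op b • op a • x)
    rw [mul_smul]
  smul_zero a := by apply LinearMap.ext; intro x; rfl
  zero_smul ξ := by
    apply LinearMap.ext; intro x
    show (ξ : Q →ₗ[k] k) ((0 : Cᵐᵒᵖ) • x) = 0
    rw [zero_smul, map_zero]
  smul_add a ξ η := by apply LinearMap.ext; intro x; rfl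
  add_smul a b ξ := by
    apply LinearMap.ext; intro x
    show (ξ : Q →ₗ[k] k) ((op a + op b) • x) =
      (ξ : Q →ₗ[k] k) (op a • x) + (ξ : Q →ₗ[k] k) (op b • x)
    rw [add_smul, map_add]

@[simp] lemma smul_ap (a : C) (ξ : KD' k Q) (x : Q) : (a • ξ) x = ξ (op a • x) := rfl

lemma alg_smul_ap (c : k) (ξ : KD' k Q) (x : Q) :
    ((algebraMap k C c) • ξ) x = c * ξ x := by
  rw [smul_ap]
  have : op (algebraMap k C c) • x = c • x := by
    rw [← MulOpposite.algebraMap_apply, algebraMap_smul]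
  rw [this, map_smul]; rfl

lemma finite [FiniteDimensional k Q] : Module.Finite C (KD' k Q) := by
  let := kmod k C (KD' k Q)
  have := kmod_tower k C (KD' k Q)
  have : FiniteDimensional k (KD' k Q) := by
    let e : (KD' k Q) ≃ₗ[k] (Q →ₗ[k] k) :=
      { toFun := fun ξ => ξ
        invFun := fun ξ => ξ
        map_add' := fun _ _ => rfl
        map_smul' := fun c ξ => LinearMap.ext fun x => alg_smul_ap (C := C) c ξ x
        left_inv := fun _ => rfl
        right_inv := fun _ => rfl }
    exact Module.Finite.equiv e.symm
  exact Module.Finite.of_restrictScalars_finite k C _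

end KD'

variable {k C : Type} [Field k] [Ring C] [Algebra k C]

lemma KD_injective {Q : Type} [AddCommGroup Q] [Module k Q] [Module C Q] [IsScalarTower k C Q]
    (hQ : Module.Projective C Q) : Module.Injective Cᵐᵒᵖ (KD k Q) := by
  apply Module.Baer.injective
  intro I g
  obtain ⟨s, hs⟩ := hQ.out
  let Ik : Submodule k C :=
    { carrier := {a | op a ∈ I}
      add_mem' := fun {a b} ha hb => by
        show op (a + b) ∈ I
        rw [MulOpposite.op_add]; exact I.add_mem ha hb
      zero_mem' := I.zero_mem
      smul_mem' := fun c a ha => by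
        show op (c • a) ∈ I
        have : op (c • a) = (c • (1 : Cᵐᵒᵖ)) * op a := by simp
        rw [this]; exact I.mul_mem_left _ ha }
  have hsm : ∀ (c : k) (a : Ik), g ⟨op (c • a : C), (c • a).2⟩ = c • g ⟨op (a : C), a.2⟩ := by
    intro c a
    have : (⟨op (c • a : C), (c • a).2⟩ : I) = (c • (1 : Cᵐᵒᵖ)) • ⟨op (a : C), a.2⟩ := by
      apply Subtype.ext; simp
    rw [this, map_smul, smul_assoc, one_smul]
  let l0 : Q → (Ik →ₗ[k] k) := fun q =>
    { toFun := fun a => g ⟨op (a : C), a.2⟩ q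
      map_add' := fun a b => by
        rw [← KD.add_ap, ← map_add]; rfl
      map_smul' := fun c a => by
        have := hsm c a
        show g ⟨op ((c • a : Ik) : C), _⟩ q = _
        rw [show g ⟨op ((c • a : Ik) : C), (c • a).2⟩ = _ from this]; rfl }
  choose l hl using fun q => LinearMap.exists_extend (l0 q)
  have hl' : ∀ q a (ha : op a ∈ I), l q a = g ⟨op a, ha⟩ q := fun q a ha =>
    LinearMap.congr_fun (hl q) ⟨a, ha⟩
  let H : KD k Q := (Finsupp.lsum k l) ∘ₗ (s.restrictScalars k)
  refine ⟨LinearMap.toSpanSingleton Cᵐᵒᵖ _ H, fun x hx => ?_⟩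
  obtain ⟨a, rfl⟩ := MulOpposite.op_surjective x
  ext y
  show H (a • y) = _
  have h1 : H (a • y) = (s y).sum fun q c => l q (a * c) := by
    show Finsupp.lsum k l (s (a • y)) = _
    rw [map_smul]
    rw [Finsupp.lsum_apply, Finsupp.sum_smul_index' (by simp)]
    rfl
  have h2 : y = (s y).sum fun q c => c • q := (hs y).symm
  rw [h1]
  conv_rhs => rw [h2]
  rw [Finsupp.sum, Finsupp.sum, map_sum]
  refine Finset.sum_congr rfl fun q _ => ?_
  have h3 : op (a * (s y) q) ∈ I := by
    rw [op_mul]; exact I.mul_mem_left _ hx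
  rw [hl' _ _ h3, ← KD.op_smul_ap, ← map_smul]
  rfl

/-- representability for nondegenerate pairings -/
lemma pair_rep {N M : Type} [AddCommGroup N] [AddCommGroup M] [Module k N] [Module k M]
    (hfin : FiniteDimensional k N ∨ FiniteDimensional k M) (φ : N → M → k)
    (h1 : ∀ n n' m, φ (n + n') m = φ n m + φ n' m)
    (h2 : ∀ n m m', φ n (m + m') = φ n m + φ n m')
    (h3 : ∀ (c : k) n m, φ n (c • m) = c * φ n m)
    (h4 : ∀ (c : k) n m, φ (c • n) m = c * φ n m)
    (h5 : ∀ n, (∀ m, φ n m = 0) → n = 0)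
    (h6 : ∀ m, (∀ n, φ n m = 0) → m = 0) :
    (∀ l : N →ₗ[k] k, ∃ m, ∀ n, l n = φ n m) ∧ (∀ l : M →ₗ[k] k, ∃ n, ∀ m, l m = φ n m) ∧
    FiniteDimensional k N ∧ FiniteDimensional k M := by
  let p : N →ₗ[k] M →ₗ[k] k := LinearMap.mk₂ k φ h1 h4 h2 h3
  have i1 : Function.Injective p := by
    rw [← LinearMap.ker_eq_bot, LinearMap.ker_eq_bot']
    exact fun n hn => h5 n fun m => LinearMap.congr_fun hn m
  have i2 : Function.Injective p.flip := by
    rw [← LinearMap.ker_eq_bot, LinearMap.ker_eq_bot']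
    exact fun m hm => h6 m fun n => LinearMap.congr_fun hm n
  have hN : FiniteDimensional k N := hfin.elim id fun h => FiniteDimensional.of_injective p i1
  have hM : FiniteDimensional k M := FiniteDimensional.of_injective p.flip i2
  have hp : p.IsPerfPair := LinearMap.IsPerfPair.of_injective i1 i2
  refine ⟨fun l => ?_, fun l => ?_, hN, hM⟩
  · obtain ⟨m, hm⟩ := hp.bijective_right.2 l
    exact ⟨m, fun n => (LinearMap.congr_fun hm n).symm⟩
  · obtain ⟨n, hn⟩ := hp.bijective_left.2 l
    exact ⟨n, fun m => (LinearMap.congr_fun hn m).symm⟩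

end KDual

open CategoryTheory MulOpposite

section TauRigidExt
variable {k C : Type} [Field k] [Ring C] [Algebra k C]

/-- the map `p ↦ m · g(p)` -/
def mulMap {P M : Type} [AddCommGroup P] [AddCommGroup M] [Module Cᵐᵒᵖ P] [Module Cᵐᵒᵖ M]
    (g : P →ₗ[Cᵐᵒᵖ] C) (m : M) : P →ₗ[Cᵐᵒᵖ] M where
  toFun p := op (g p) • m
  map_add' p q := by rw [map_add, MulOpposite.op_add, add_smul]
  map_smul' r p := by
    rw [map_smul, RingHom.id_apply, smul_smul]
    rfl

section
variable {P M : Type} [AddCommGroup P] [AddCommGroup M] [Module Cᵐᵒᵖ P] [Module Cᵐᵒᵖ M]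

lemma mulMap_apply (g : P →ₗ[Cᵐᵒᵖ] C) (m : M) (p : P) : mulMap g m p = op (g p) • m := rfl

lemma mulMap_add_left (g g' : P →ₗ[Cᵐᵒᵖ] C) (m : M) :
    mulMap (g + g') m = mulMap g m + mulMap g' m := by
  ext p; simp [mulMap_apply, add_smul]

lemma mulMap_add_right (g : P →ₗ[Cᵐᵒᵖ] C) (m m' : M) :
    mulMap g (m + m') = mulMap g m + mulMap g m' := by
  ext p; simp [mulMap_apply]

lemma mulMap_smul (c : C) (g : P →ₗ[Cᵐᵒᵖ] C) (m : M) :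
    mulMap (c • g) m = mulMap g (op c • m) := by
  ext p; simp [mulMap_apply, mul_smul]

lemma dual_basis (hP : Module.Projective Cᵐᵒᵖ P) [Module.Finite Cᵐᵒᵖ P] :
    ∃ (n : ℕ) (x : Fin n → P) (ξ : Fin n → (P →ₗ[Cᵐᵒᵖ] C)), ∀ p, p = ∑ i, op (ξ i p) • x i := by
  obtain ⟨n, f, hf⟩ := Module.Finite.exists_fin' Cᵐᵒᵖ P
  obtain ⟨s, hs⟩ := proj_lift hP f hf LinearMap.id
  refine ⟨n, fun i => f (Pi.single i 1), fun i =>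
    { toFun := fun p => unop (s p i)
      map_add' := fun p q => by simp
      map_smul' := fun r p => by simp }, fun p => ?_⟩
  conv_lhs => rw [← LinearMap.id_apply (R := Cᵐᵒᵖ) p, ← hs p]
  simp only [LinearMap.coe_mk, AddHom.coe_mk, op_unop, ← map_smul, ← map_sum]
  congr 1
  ext j
  simp [Finset.sum_apply, Pi.single_apply]

end

lemma homZero_of_surj {P1 P0 M T : Mdl Cᵐᵒᵖ} [Module.Finite Cᵐᵒᵖ P1] [Module.Finite Cᵐᵒᵖ P0]
    (hP1 : Module.Projective Cᵐᵒᵖ P1) (hP0 : Module.Projective Cᵐᵒᵖ P0)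
    (d1 : P1 →ₗ[Cᵐᵒᵖ] P0) (Tr : Mdl C) (q : (P1 →ₗ[Cᵐᵒᵖ] C) →ₗ[C] Tr)
    (hq : Function.Surjective q) (hq0 : ∀ f : P0 →ₗ[Cᵐᵒᵖ] C, q (f.comp d1) = 0)
    (hD : IskDual k C T Tr)
    (h : ∀ u : P1 →ₗ[Cᵐᵒᵖ] M, ∃ v : P0 →ₗ[Cᵐᵒᵖ] M, ∀ x, u x = v (d1 x)) :
    HomZero Cᵐᵒᵖ M T := by
  intro h'
  obtain ⟨φ, a1, a2, a3, a4, a5, a6⟩ := hD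
  obtain ⟨n, x, ξ, hx⟩ := dual_basis hP1
  obtain ⟨n', y, η, hy⟩ := dual_basis hP0
  have hz : ∀ t, φ 0 t = 0 := fun t => by simpa using a1 0 0 t
  have hz' : ∀ t, φ t 0 = 0 := fun t => by simpa using a2 t 0 0
  have hs1 : ∀ (ι : Type) (s : Finset ι) (f : ι → T) t, φ (∑ i ∈ s, f i) t = ∑ i ∈ s, φ (f i) t := by
    intro ι s f t
    exact map_sum (AddMonoidHom.mk' (fun z => φ z t) (fun a b => a1 a b t)) f s
  have hs2 : ∀ (ι : Type) (s : Finset ι) (f : ι → Tr) t, φ t (∑ i ∈ s, f i) = ∑ i ∈ s, φ t (f i) := by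
    intro ι s f t
    exact map_sum (AddMonoidHom.mk' (fun z => φ t z) (fun a b => a2 t a b)) f s
  have key : ∀ (m : M) (g : P1 →ₗ[Cᵐᵒᵖ] C),
      ∑ i, φ (h' (op (g (x i)) • m)) (q (ξ i)) = φ (h' m) (q g) := by
    intro m g
    have hg : g = ∑ i, g (x i) • ξ i := by
      ext p
      conv_lhs => rw [hx p]
      simp [LinearMap.sum_apply]
    conv_rhs => rw [hg]
    rw [map_sum, hs2]
    refine Finset.sum_congr rfl fun i _ => ?_
    rw [map_smul, a4, map_smul]
  ext m
  apply a5
  intro t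
  obtain ⟨g, rfl⟩ := hq t
  rw [← key]
  obtain ⟨v, hv⟩ := h (mulMap g m)
  have e : ∀ i, op (g (x i)) • m = ∑ j, op ((η j).comp d1 (x i)) • v (y j) := by
    intro i
    rw [← mulMap_apply, hv]
    conv_lhs => rw [hy (d1 (x i))]
    simp
  simp_rw [e, map_sum, hs1]
  rw [Finset.sum_comm]
  refine Finset.sum_eq_zero fun j _ => ?_
  rw [key, hq0, hz']

lemma exists_tau_surj [FiniteDimensional k C] (M : Mdl Cᵐᵒᵖ) {P1 P0 : Mdl Cᵐᵒᵖ}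
    [Module.Finite Cᵐᵒᵖ P1]
    {d1 : P1 →ₗ[Cᵐᵒᵖ] P0} {d0 : P0 →ₗ[Cᵐᵒᵖ] M} (hpres : IsMinPres Cᵐᵒᵖ d1 d0)
    (h : TauRigid k C M) (u : P1 →ₗ[Cᵐᵒᵖ] M) :
    ∃ v : P0 →ₗ[Cᵐᵒᵖ] M, ∀ x, u x = v (d1 x) := by
  let S : Submodule C (P1 →ₗ[Cᵐᵒᵖ] C) :=
    { carrier := {g | ∃ f : P0 →ₗ[Cᵐᵒᵖ] C, g = f.comp d1}
      add_mem' := by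
        rintro _ _ ⟨f, rfl⟩ ⟨f', rfl⟩
        exact ⟨f + f', by ext; simp⟩
      zero_mem' := ⟨0, by ext; simp⟩
      smul_mem' := by
        rintro c _ ⟨f, rfl⟩
        exact ⟨c • f, by ext; simp⟩ }
  let Tr : Mdl C := ModuleCat.of C ((P1 →ₗ[Cᵐᵒᵖ] C) ⧸ S)
  let := kmod k C Tr
  have := kmod_tower k C Tr
  let q : (P1 →ₗ[Cᵐᵒᵖ] C) →ₗ[C] Tr := S.mkQ
  have hq : Function.Surjective q := S.mkQ_surjective
  have hq0 : ∀ g, q g = 0 ↔ ∃ f : P0 →ₗ[Cᵐᵒᵖ] C, g = f.comp d1 := fun g =>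
    Submodule.Quotient.mk_eq_zero S
  have hdual : IskDual k C (ModuleCat.of Cᵐᵒᵖ (KD k Tr)) Tr := by
    refine ⟨fun ξ t => (show KD k Tr from ξ) t, fun _ _ _ => rfl, fun ξ t t' => ?_, fun c ξ t => ?_,
      fun a ξ t => rfl, fun ξ hξ => KD.ext' hξ, fun t ht => ?_⟩
    · exact map_add (show KD k Tr from ξ) t t'
    · exact LinearMap.map_smul (show Tr →ₗ[k] k from ξ) c t
    · by_contra hne
      obtain ⟨l, hl, -⟩ := Submodule.exists_le_ker_of_notMem (K := k) (p := (⊥ : Submodule k Tr))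
        (v := t) (by simpa using hne)
      exact hl (ht l)
  have hT : HomZero Cᵐᵒᵖ M (ModuleCat.of Cᵐᵒᵖ (KD k Tr)) :=
    h _ ⟨P1, P0, d1, d0, hpres, Tr, q, hq, hq0, hdual⟩
  by_contra hcon
  let := kmod k Cᵐᵒᵖ M
  have := kmod_tower k Cᵐᵒᵖ M
  have : SMulCommClass Cᵐᵒᵖ k M := IsScalarTower.to_smulCommClass'
  let U : Submodule k (P1 →ₗ[Cᵐᵒᵖ] M) :=
    { carrier := {u | ∃ v : P0 →ₗ[Cᵐᵒᵖ] M, ∀ x, u x = v (d1 x)}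
      add_mem' := by
        rintro u u' ⟨f, hf⟩ ⟨f', hf'⟩
        exact ⟨f + f', by simp [hf, hf']⟩
      zero_mem' := ⟨0, by simp⟩
      smul_mem' := by
        rintro c u ⟨f, hf⟩
        exact ⟨c • f, by simp [hf]⟩ }
  obtain ⟨l, hl, hU⟩ := Submodule.exists_le_ker_of_notMem (K := k) (p := U) (v := u) hcon
  have hcongr : ∀ (m : M) (g g' : P1 →ₗ[Cᵐᵒᵖ] C), q g = q g' → l (mulMap g m) = l (mulMap g' m) := by
    intro m g g' hgg
    obtain ⟨f, hf⟩ := (hq0 (g - g')).1 (by rw [map_sub, hgg, sub_self])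
    have h1 : mulMap (g - g') m ∈ U := ⟨mulMap f m, fun x => by rw [hf]; rfl⟩
    have h2 : g = (g - g') + g' := by simp
    rw [h2, mulMap_add_left, map_add, LinearMap.mem_ker.1 (hU h1), zero_add]
  choose r hr using hq
  let hh : M →ₗ[Cᵐᵒᵖ] KD k Tr :=
    { toFun := fun m =>
        ({ toFun := fun t => l (mulMap (r t) m)
           map_add' := fun t t' => by
            rw [← map_add, ← mulMap_add_left]
            apply hcongr; simp [hr]
           map_smul' := fun c t => by
            have e1 : c • mulMap (r t) m = mulMap (algebraMap k C c • r t) m := by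
              rw [mulMap_smul]
              ext x
              rw [LinearMap.smul_apply, mulMap_apply, mulMap_apply]
              rw [smul_comm, ← MulOpposite.algebraMap_apply, algebraMap_smul]
            rw [RingHom.id_apply, ← map_smul, e1]
            apply hcongr
            rw [hr, map_smul, hr]; rfl } : Tr →ₗ[k] k)
      map_add' := fun m m' => by
        apply KD.ext'
        intro t
        show l (mulMap (r t) (m + m')) = l (mulMap (r t) m) + l (mulMap (r t) m')
        rw [mulMap_add_right, map_add]
      map_smul' := fun a m => by
        obtain ⟨a, rfl⟩ := MulOpposite.op_surjective a
        apply KD.ext'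
        intro t
        show l (mulMap (r t) (op a • m)) = l (mulMap (r (a • t)) m)
        rw [← mulMap_smul]
        apply hcongr
        rw [hr, map_smul, hr] }
  have hh0 : hh = 0 := hT hh
  obtain ⟨n, x, ξ, hx⟩ := dual_basis hpres.2.1
  apply hl
  have hu : u = ∑ i, mulMap (ξ i) (u (x i)) := by
    ext p
    conv_lhs => rw [hx p]
    simp [LinearMap.sum_apply, mulMap_apply]
  rw [hu, map_sum]
  refine Finset.sum_eq_zero fun i _ => ?_
  have h3 : hh (u (x i)) = 0 := by rw [hh0]; rfl
  have h4 : (hh (u (x i))) (q (ξ i)) = 0 := by rw [h3]; rfl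
  rw [← h4]
  exact hcongr _ _ _ (hr _).symm


theorem tauRigid_iff (k C : Type) [Field k] [Ring C] [Algebra k C] [FiniteDimensional k C]
    (M : Mdl Cᵐᵒᵖ) [Module.Finite Cᵐᵒᵖ M] :
    TauRigid k C M ↔ ∀ X, MemGen Cᵐᵒᵖ M X → Ext1Zero Cᵐᵒᵖ M X := by
  have : FiniteDimensional k Cᵐᵒᵖ := Module.Finite.equiv (MulOpposite.opLinearEquiv k)
  have : IsArtinianRing Cᵐᵒᵖ := IsArtinianRing.of_finite k Cᵐᵒᵖ
  constructor
  · intro h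
    obtain ⟨P1, P0, d1, d0, hp⟩ := exists_minPres M
    have := hp.finite.2
    exact ext_of_surj hp (exists_tau_surj M hp h)
  · rintro h T ⟨P1, P0, d1, d0, hp, Tr, q, hq, hq0, hD⟩
    obtain ⟨hf0, hf1⟩ := hp.finite
    exact homZero_of_surj hp.2.1 hp.1.1 d1 Tr q hq (fun f => (hq0 _).2 ⟨f, rfl⟩) hD
      (surj_of_ext hp h)

end TauRigidExt

open CategoryTheory MulOpposite

section SplitPart
variable (C : Type) [Ring C] (E : Type) [AddCommGroup E]
  [Module C E] [Module Cᵐᵒᵖ E] [SMulCommClass C Cᵐᵒᵖ E]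

/-- there is no nonzero balanced map `M × E → X`, i.e. `Hom_C(M ⊗ E, X) = 0` -/
def BalZero (C : Type) [Ring C] (E : Type) [AddCommGroup E] [Module C E] [Module Cᵐᵒᵖ E]
    (M X : Mdl Cᵐᵒᵖ) : Prop :=
  ∀ β : M → E → X, (∀ m m' e, β (m + m') e = β m e + β m' e) →
    (∀ m e e', β m (e + e') = β m e + β m e') →
    (∀ (c : C) m e, β m (op c • e) = op c • β m e) →
    (∀ (c : C) m e, β (op c • m) e = β m (c • e)) → ∀ m e, β m e = 0

/-- the extension of `M` by `X` given by a balanced map -/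
def ZExt (M X : Type) (_β : M → E → X) : Type := X × M

instance (M X : Type) [AddCommGroup M] [AddCommGroup X] (β : M → E → X) :
    AddCommGroup (ZExt E M X β) := inferInstanceAs (AddCommGroup (X × M))

/-- the module structure -/
def ZExt.module (M X : Type) [AddCommGroup M] [AddCommGroup X] [Module Cᵐᵒᵖ M] [Module Cᵐᵒᵖ X]
    (β : M → E → X) (h1 : ∀ m m' e, β (m + m') e = β m e + β m' e)
    (h2 : ∀ m e e', β m (e + e') = β m e + β m e')
    (h3 : ∀ (c : C) m e, β m (op c • e) = op c • β m e)
    (h4 : ∀ (c : C) m e, β (op c • m) e = β m (c • e)) :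
    Module (TrivSqZeroExt C E)ᵐᵒᵖ (ZExt E M X β) where
  smul b z := ((op (unop b).fst • z.1 + β z.2 (unop b).snd, op (unop b).fst • z.2) : X × M)
  one_smul z := by
    have h0 : ∀ m, β m 0 = 0 := fun m => by simpa using h2 m 0 0
    show ((op (1 : TrivSqZeroExt C E).fst • z.1 + β z.2 (1 : TrivSqZeroExt C E).snd,
      op (1 : TrivSqZeroExt C E).fst • z.2) : X × M) = z
    simp [h0]
    rfl
  mul_smul a b z := by
    show ((op (unop b * unop a).fst • z.1 + β z.2 (unop b * unop a).snd,
      op (unop b * unop a).fst • z.2) : X × M) =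
      (op (unop a).fst • (op (unop b).fst • z.1 + β z.2 (unop b).snd) +
        β (op (unop b).fst • z.2) (unop a).snd, op (unop a).fst • op (unop b).fst • z.2)
    rw [TrivSqZeroExt.fst_mul, TrivSqZeroExt.snd_mul, op_mul, mul_smul, mul_smul, h2, h3, h4,
      smul_add]
    ext
    · simp only; abel
    · rfl
  smul_zero a := by
    have h0 : ∀ e, β 0 e = 0 := fun e => by simpa using h1 0 0 e
    show ((op (unop a).fst • (0 : X) + β 0 (unop a).snd, op (unop a).fst • (0 : M)) : X × M) = 0
    simp [h0]
  smul_add a z w := by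
    show ((op (unop a).fst • (z.1 + w.1) + β (z.2 + w.2) (unop a).snd,
      op (unop a).fst • (z.2 + w.2)) : X × M) =
      ((op (unop a).fst • z.1 + β z.2 (unop a).snd) +
        (op (unop a).fst • w.1 + β w.2 (unop a).snd),
        op (unop a).fst • z.2 + op (unop a).fst • w.2)
    rw [smul_add, smul_add, h1]
    ext
    · simp only; abel
    · rfl
  add_smul a b z := by
    show ((op (unop a + unop b).fst • z.1 + β z.2 (unop a + unop b).snd,
      op (unop a + unop b).fst • z.2) : X × M) =
      ((op (unop a).fst • z.1 + β z.2 (unop a).snd) +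
        (op (unop b).fst • z.1 + β z.2 (unop b).snd),
        op (unop a).fst • z.2 + op (unop b).fst • z.2)
    rw [TrivSqZeroExt.fst_add, TrivSqZeroExt.snd_add, h2, MulOpposite.op_add, add_smul, add_smul]
    ext
    · simp only; abel
    · rfl
  zero_smul z := by
    have h0 : ∀ m, β m 0 = 0 := fun m => by simpa using h2 m 0 0
    show ((op (0 : TrivSqZeroExt C E).fst • z.1 + β z.2 (0 : TrivSqZeroExt C E).snd,
      op (0 : TrivSqZeroExt C E).fst • z.2) : X × M) = (0, 0)
    simp [h0]

variable {C E}

lemma modB_smul (M : Mdl Cᵐᵒᵖ) (b : TrivSqZeroExt C E) (m : M) :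
    (op b • (show modB C E M from m) : modB C E M) = (show modB C E M from op b.fst • m) := rfl

lemma bal_of_ext (M : Mdl Cᵐᵒᵖ)
    (h : ∀ Y, MemGen _ (modB C E M) Y → Ext1Zero (TrivSqZeroExt C E)ᵐᵒᵖ (modB C E M) Y)
    (X : Mdl Cᵐᵒᵖ) (hX : MemGen Cᵐᵒᵖ M X) : BalZero C E M X := by
  intro β h1 h2 h3 h4
  letI := ZExt.module C E M X β h1 h2 h3 h4
  have h00 : ∀ e, β 0 e = 0 := fun e => by simpa using h1 0 0 e
  have hgen : MemGen _ (modB C E M) (modB C E X) := by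
    obtain ⟨d, f, hf⟩ := hX
    refine ⟨d, { toFun := fun v => f v, map_add' := fun v w => f.map_add v w,
                 map_smul' := fun b v => ?_ }, hf⟩
    exact f.map_smul (op (unop b).fst) v
  obtain ⟨s, hs⟩ := h _ hgen (ModuleCat.of _ (ZExt E M X β))
    { toFun := fun x => ((show X from x, (0 : M)) : X × M)
      map_add' := fun x y => by
        show (_ : X × M) = (_ + _, (0 : M) + 0)
        rw [add_zero]; rfl
      map_smul' := fun b x => by
        show (_ : X × M) = (op (unop b).fst • (show X from x) + β 0 (unop b).snd,
          op (unop b).fst • (0 : M))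
        rw [h00, smul_zero, add_zero]; rfl }
    { toFun := fun z => (show X × M from z).2
      map_add' := fun _ _ => rfl
      map_smul' := fun _ _ => rfl }
    (fun x y hxy => congrArg Prod.fst hxy)
    (fun m => ⟨((0, m) : X × M), rfl⟩)
    (by
      ext z
      constructor
      · rintro ⟨x, rfl⟩; rfl
      · intro hz
        exact ⟨(show X × M from z).1, Prod.ext rfl (Eq.symm hz)⟩)
  intro m e
  have e1 : (show X × M from s m).2 = m := LinearMap.congr_fun hs m
  have e2 : s (op (TrivSqZeroExt.inr e : TrivSqZeroExt C E) • (show modB C E M from m)) =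
    op (TrivSqZeroExt.inr e : TrivSqZeroExt C E) • s m := map_smul _ _ _
  rw [modB_smul, TrivSqZeroExt.fst_inr, op_zero, zero_smul] at e2
  have e3 : s (show modB C E M from (0 : M)) = 0 := map_zero s
  rw [e3] at e2
  have e4 := congrArg (fun z : ZExt E M X β => (show X × M from z).1) e2
  have e5 : (0 : X) = op (0 : C) • (show X × M from s m).1 + β (show X × M from s m).2 e := e4
  rw [e1, op_zero, zero_smul, zero_add] at e5
  exact e5.symm

lemma ext_of_bal (M : Mdl Cᵐᵒᵖ)
    (hC : ∀ X, MemGen Cᵐᵒᵖ M X → Ext1Zero Cᵐᵒᵖ M X)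
    (h : ∀ X : Mdl Cᵐᵒᵖ, MemGen Cᵐᵒᵖ M X → BalZero C E M X)
    (Y) (hY : MemGen _ (modB C E M) Y) : Ext1Zero (TrivSqZeroExt C E)ᵐᵒᵖ (modB C E M) Y := by
  intro Z i p hi hp hex
  let YC : Module Cᵐᵒᵖ Y := Module.compHom Y (RingHom.op (tszeInl C E))
  let ZC : Module Cᵐᵒᵖ Z := Module.compHom Z (RingHom.op (tszeInl C E))
  have hYs : ∀ (c : C) (y : Y), op c • y = op (TrivSqZeroExt.inl c : TrivSqZeroExt C E) • y :=
    fun _ _ => rfl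
  have hZs : ∀ (c : C) (y : Z), op c • y = op (TrivSqZeroExt.inl c : TrivSqZeroExt C E) • y :=
    fun _ _ => rfl
  let Y' : Mdl Cᵐᵒᵖ := ModuleCat.of Cᵐᵒᵖ Y
  let Z' : Mdl Cᵐᵒᵖ := ModuleCat.of Cᵐᵒᵖ Z
  have hgen : MemGen Cᵐᵒᵖ M Y' := by
    obtain ⟨d, f, hf⟩ := hY
    refine ⟨d, { toFun := fun v => f v, map_add' := fun v w => f.map_add v w,
                 map_smul' := fun b v => ?_ }, hf⟩
    exact f.map_smul (op (TrivSqZeroExt.inl (unop b) : TrivSqZeroExt C E)) v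
  let i' : Y' →ₗ[Cᵐᵒᵖ] Z' :=
    { toFun := fun y => i y, map_add' := fun v w => i.map_add v w
      map_smul' := fun b v => i.map_smul (op (TrivSqZeroExt.inl (unop b) : TrivSqZeroExt C E)) v }
  let p' : Z' →ₗ[Cᵐᵒᵖ] M :=
    { toFun := fun y => p y, map_add' := fun v w => p.map_add v w
      map_smul' := fun b v => p.map_smul (op (TrivSqZeroExt.inl (unop b) : TrivSqZeroExt C E)) v }
  have hk : ∀ z : Z, p z = 0 → ∃ y, i y = z := fun z hz => by
    have : z ∈ LinearMap.ker p := hz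
    rw [← hex] at this
    exact this
  have hip : ∀ y, p (i y) = 0 := fun y => by
    have : i y ∈ LinearMap.range i := ⟨y, rfl⟩
    rw [hex] at this
    exact this
  obtain ⟨s, hs⟩ := hC Y' hgen Z' i' p' hi hp (by
    ext z
    exact ⟨fun ⟨y, hy⟩ => hy ▸ hip y, fun hz => hk z hz⟩)
  have hs' : ∀ m : M, p (s m : Z) = m := fun m => LinearMap.congr_fun hs m
  have hβ : ∀ (m : M) (e : E), ∃ y : Y,
      i y = op (TrivSqZeroExt.inr e : TrivSqZeroExt C E) • (s m : Z) := fun m e => hk _ (by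
    rw [map_smul, hs', modB_smul, TrivSqZeroExt.fst_inr, op_zero, zero_smul]; rfl)
  choose β hβ using hβ
  have hi' : ∀ (b : TrivSqZeroExt C E) (y : Y), i (op b • y) = op b • i y := fun b y =>
    i.map_smul _ _
  have hsc : ∀ (c : C) (m : M), (s (op c • m) : Z) =
      op (TrivSqZeroExt.inl c : TrivSqZeroExt C E) • (s m : Z) := fun c m => s.map_smul _ _
  have hb0 := h Y' hgen β
    (fun m m' e => hi (by
      rw [hβ, s.map_add]
      refine (smul_add _ _ _).trans ?_
      rw [← hβ, ← hβ]; exact (i.map_add _ _).symm))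
    (fun m e e' => hi (by
      rw [hβ, TrivSqZeroExt.inr_add, MulOpposite.op_add]
      refine (add_smul _ _ _).trans ?_
      rw [← hβ, ← hβ]; exact (i.map_add _ _).symm))
    (fun c m e => hi (by
      have : i ((op c • (β m e : Y') : Y') : Y) = op (TrivSqZeroExt.inl c : TrivSqZeroExt C E) •
        i (β m e) := hi' _ _
      rw [this, hβ, hβ]
      refine Eq.trans ?_ (mul_smul _ _ _)
      rw [← op_mul, TrivSqZeroExt.inr_mul_inl]))
    (fun c m e => hi (by
      rw [hβ, hβ, hsc]
      refine (mul_smul _ _ _).symm.trans ?_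
      rw [← op_mul, TrivSqZeroExt.inl_mul_inr]))
  have e0 : ∀ (m : M) e, op (TrivSqZeroExt.inr e : TrivSqZeroExt C E) • (s m : Z) = 0 :=
    fun m e => by rw [← hβ, hb0]; exact i.map_zero
  refine ⟨{ toFun := fun m => (s m : Z), map_add' := fun v w => s.map_add v w
            map_smul' := fun b m => ?_ }, ?_⟩
  · obtain ⟨b, rfl⟩ := MulOpposite.op_surjective b
    show (s (op b.fst • (show M from m)) : Z) = op b • (s m : Z)
    have e1 : op (TrivSqZeroExt.inr b.snd : TrivSqZeroExt C E) • (s m : Z) = 0 := e0 m b.snd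
    rw [hsc]
    conv_rhs => rw [← TrivSqZeroExt.inl_fst_add_inr_snd_eq b, MulOpposite.op_add]
    refine Eq.trans ?_ (add_smul _ _ _).symm
    rw [e1, add_zero]
  · ext m
    exact hs' m

end SplitPart

open CategoryTheory MulOpposite

section TiltSide
variable {R : Type} [Ring R]

lemma ker_proj {X : Mdl R} (hX : PdLE1 R X) {F : Type} [AddCommGroup F] [Module R F]
    (hF : Module.Projective R F) (p : F →ₗ[R] X) (hp : Function.Surjective p) :
    Module.Projective R (LinearMap.ker p) := by
  obtain ⟨Q1, Q0, e1, e0, hQ1, hQ0, he1, he0, hex⟩ := hX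
  obtain ⟨α, hα⟩ := proj_lift hQ0 p hp e0
  obtain ⟨β, hβ⟩ := proj_lift hF e0 he0 p
  obtain ⟨γ, hγ⟩ := factor_inj (β ∘ₗ (LinearMap.ker p).subtype) e1 he1 (fun u => by
    have : β u.1 ∈ LinearMap.ker e0 := by
      rw [LinearMap.mem_ker, hβ]; exact u.2
    rw [← hex] at this
    exact this)
  have h0 : ∀ q, e0 (e1 q) = 0 := fun q => by
    have : e1 q ∈ LinearMap.range e1 := ⟨q, rfl⟩
    rw [hex] at this
    exact this
  let s : LinearMap.ker p →ₗ[R] Q1 × F := γ.prod (LinearMap.ker p).subtype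
  let r : Q1 × F →ₗ[R] LinearMap.ker p := LinearMap.codRestrict (LinearMap.ker p)
    (α ∘ₗ e1 ∘ₗ LinearMap.fst R Q1 F + LinearMap.snd R Q1 F - α ∘ₗ β ∘ₗ LinearMap.snd R Q1 F)
    (fun z => by simp [hα, hβ, h0])
  refine Module.Projective.of_split s r ?_
  ext u
  have : e1 (γ u) = β u.1 := hγ u
  show α (e1 (γ u)) + u.1 - α (β u.1) = u.1
  rw [this, add_sub_cancel_left]

lemma tilt_section (hh : ∀ N : Mdl R, PdLE1 R N) (T : Mdl R) (hT : Ext1Zero R T T)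
    {n m : ℕ} (r : (Fin m → T) →ₗ[R] (Fin n → T))
    (hfac : ∀ f : T →ₗ[R] (Fin n → T), (∀ t, f t ∈ LinearMap.range r) →
      ∃ c : T →ₗ[R] (Fin m → T), ∀ t, r (c t) = f t) :
    ∃ s : LinearMap.range r →ₗ[R] (Fin m → T), ∀ u, r (s u) = u.1 := by
  obtain ⟨P1, P0, d1, d0, hP1, hP0, hd1, hd0, hex⟩ := hh T
  have hz : ∀ q, d0 (d1 q) = 0 := fun q => by
    have : d1 q ∈ LinearMap.range d1 := ⟨q, rfl⟩
    rw [hex] at this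
    exact this
  have hz' : ∀ q, d0 q = 0 → ∃ x, d1 x = q := fun q hq => by
    have : q ∈ LinearMap.ker d0 := hq
    rw [← hex] at this
    exact this
  have hext : ∀ θ : P1 →ₗ[R] (Fin m → T), (∀ x, r (θ x) = 0) →
      ∃ θ' : P0 →ₗ[R] (Fin m → T), (∀ x, θ' (d1 x) = θ x) ∧ ∀ y, r (θ' y) = 0 := by
    intro θ hθ
    choose w hw using fun j => ext1_extend hT d1 d0 hd1 hd0 hex (LinearMap.proj j ∘ₗ θ)
    have hw' : ∀ x, LinearMap.pi w (d1 x) = θ x := fun x => by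
      ext j; exact hw j x
    obtain ⟨f, hf⟩ := factor_surj (r ∘ₗ LinearMap.pi w) d0 hd0 (fun a ha => by
      obtain ⟨x, rfl⟩ := hz' a ha
      rw [LinearMap.comp_apply, hw', hθ])
    obtain ⟨c, hc⟩ := hfac f (fun t => by
      obtain ⟨a, rfl⟩ := hd0 t
      rw [hf]; exact ⟨_, rfl⟩)
    refine ⟨LinearMap.pi w - c ∘ₗ d0, fun x => ?_, fun y => ?_⟩
    · rw [LinearMap.sub_apply, hw', LinearMap.comp_apply, hz, map_zero, sub_zero]
    · rw [LinearMap.sub_apply, map_sub, LinearMap.comp_apply, hc, hf, LinearMap.comp_apply,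
        sub_self]
  let π : (Fin n → P0) →ₗ[R] (Fin n → T) := LinearMap.pi fun i => d0 ∘ₗ LinearMap.proj i
  have hπ : Function.Surjective π := fun t => by
    choose y hy using fun i => hd0 (t i)
    exact ⟨y, funext hy⟩
  let p : (Fin n → P0) →ₗ[R] ((Fin n → T) ⧸ LinearMap.range r) := (LinearMap.range r).mkQ ∘ₗ π
  have hU : Module.Projective R (LinearMap.ker p) :=
    ker_proj (X := ModuleCat.of R ((Fin n → T) ⧸ LinearMap.range r)) (hh _)
      (Module.Projective.of_equiv (DFinsupp.linearEquivFunOnFintype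
        (ι := Fin n) (M := fun _ => (P0 : Type)) (R := R))) p
      ((LinearMap.range r).mkQ_surjective.comp hπ)
  have hpU : ∀ x, p x = 0 ↔ π x ∈ LinearMap.range r := fun x =>
    Submodule.Quotient.mk_eq_zero _
  obtain ⟨ℓ, hℓ⟩ := proj_lift' hU r (π ∘ₗ (LinearMap.ker p).subtype)
    (fun u => (hpU u.1).1 u.2)
  -- the inclusion of each copy of P1
  have hsing : ∀ i (x : P1), π (Pi.single i (d1 x)) = 0 := fun i x => by
    funext j
    show d0 ((Pi.single i (d1 x) : Fin n → P0) j) = 0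
    by_cases h : j = i
    · subst h; rw [Pi.single_eq_same, hz]
    · rw [Pi.single_eq_of_ne h, map_zero]
  let δ : ∀ i, P1 →ₗ[R] LinearMap.ker p := fun i => LinearMap.codRestrict (LinearMap.ker p)
    (LinearMap.single R (fun _ : Fin n => (P0 : Type)) i ∘ₗ d1) (fun x => by
      rw [LinearMap.mem_ker, hpU]
      show π (Pi.single i (d1 x)) ∈ _
      rw [hsing]; exact Submodule.zero_mem _)
  choose θ hθ1 hθ2 using fun i => hext (ℓ ∘ₗ δ i) (fun x => by
    rw [LinearMap.comp_apply, hℓ]; exact hsing i x)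
  let Θ : (Fin n → P0) →ₗ[R] (Fin m → T) := ∑ i, θ i ∘ₗ LinearMap.proj i
  have hΘ : ∀ y, Θ y = ∑ i, θ i (y i) := fun y => by simp [Θ]
  obtain ⟨s, hs⟩ := factor_surj (ℓ - Θ ∘ₗ (LinearMap.ker p).subtype)
    (LinearMap.codRestrict (LinearMap.range r) (π ∘ₗ (LinearMap.ker p).subtype)
      (fun u => (hpU u.1).1 u.2))
    (by
      rintro ⟨t, ht⟩
      obtain ⟨y, rfl⟩ := hπ t
      exact ⟨⟨y, (hpU y).2 ht⟩, rfl⟩)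
    (by
      rintro ⟨y, hy⟩ h0
      have h0 : π y = 0 := congrArg Subtype.val h0
      choose x hx using fun i => hz' (y i) (congrFun h0 i)
      have e1 : (⟨y, hy⟩ : LinearMap.ker p) = ∑ i, δ i (x i) := by
        apply Subtype.ext
        rw [AddSubmonoidClass.coe_finsetSum]
        show y = ∑ i, Pi.single i (d1 (x i))
        simp only [hx]
        exact (Finset.univ_sum_single y).symm
      rw [LinearMap.sub_apply]
      show ℓ ⟨y, hy⟩ - Θ y = 0
      rw [e1, hΘ, map_sum, ← Finset.sum_sub_distrib]
      apply Finset.sum_eq_zero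
      intro i _
      rw [← hx i, hθ1]; exact sub_self _)
  refine ⟨s, ?_⟩
  rintro ⟨t, ht⟩
  obtain ⟨y, rfl⟩ := hπ t
  have := hs ⟨y, (hpU y).2 ht⟩
  have e2 : s ⟨π y, ht⟩ = ℓ ⟨y, (hpU y).2 ht⟩ - Θ y := this
  rw [e2, map_sub, hℓ, hΘ, map_sum]
  simp [hθ2]

/-- kernels of maps of free modules over the endomorphism ring are projective -/
lemma tilt_ker_proj (hh : ∀ N : Mdl R, PdLE1 R N) (T : Mdl R) (hT : Ext1Zero R T T)
    {C : Type} [Ring C] [IsNoetherianRing Cᵐᵒᵖ] (ε : C ≃+* Module.End R T) {n : ℕ}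
    (α : (Fin n → Cᵐᵒᵖ) →ₗ[Cᵐᵒᵖ] Cᵐᵒᵖ) :
    Module.Projective Cᵐᵒᵖ (LinearMap.ker α) := by
  let F : (Fin n → Cᵐᵒᵖ) → (T →ₗ[R] (Fin n → T)) := fun v =>
    LinearMap.pi fun i => ε (unop (v i))
  have hFa : ∀ v w, F (v + w) = F v + F w := fun v w => by
    ext t i; simp [F]
  have hFs : ∀ c v t, F (c • v) t = F v (ε (unop c) t) := fun c v t => by
    funext i; simp [F]
  have hFsum : ∀ {ι : Type} (s : Finset ι) (v : ι → Fin n → Cᵐᵒᵖ) t,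
      F (∑ j ∈ s, v j) t = ∑ j ∈ s, F (v j) t := fun s v t => by
    classical
    induction s using Finset.induction_on with
    | empty => funext i; simp [F]
    | insert a s ha ih => rw [Finset.sum_insert ha, Finset.sum_insert ha, hFa, ← ih]; rfl
  have hα : ∀ v, α v = ∑ i, v i * α (Pi.single i 1) := fun v => by
    conv_lhs => rw [← Finset.univ_sum_single v, map_sum]
    refine Finset.sum_congr rfl fun i _ => ?_
    rw [← smul_eq_mul, ← map_smul, ← Pi.single_smul, smul_eq_mul, mul_one]
  -- generators
  obtain ⟨m, v, hv⟩ := Submodule.fg_iff_exists_fin_generating_family.1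
    (IsNoetherian.noetherian (LinearMap.ker α))
  have hvk : ∀ j, α (v j) = 0 := fun j => by
    have : v j ∈ LinearMap.ker α := by rw [← hv]; exact Submodule.subset_span ⟨j, rfl⟩
    exact this
  have hgen : ∀ w, α w = 0 → ∃ c : Fin m → Cᵐᵒᵖ, ∑ j, c j • v j = w := fun w hw => by
    have : w ∈ LinearMap.ker α := hw
    rw [← hv] at this
    exact (Submodule.mem_span_range_iff_exists_fun _).1 this
  let r : (Fin m → T) →ₗ[R] (Fin n → T) := ∑ j, F (v j) ∘ₗ LinearMap.proj j
  have hr : ∀ t, r t = ∑ j, F (v j) (t j) := fun t => by simp [r]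
  let Φ : (Fin n → T) →ₗ[R] T := ∑ i, ε (unop (α (Pi.single i 1))) ∘ₗ LinearMap.proj i
  have hΦ : ∀ w t, Φ (F w t) = ε (unop (α w)) t := fun w t => by
    rw [hα w]
    simp [Φ, F]
  have hΦr : ∀ t, Φ (r t) = 0 := fun t => by
    rw [hr, map_sum]
    exact Finset.sum_eq_zero fun j _ => by rw [hΦ, hvk]; simp
  have hfac' : ∀ w, α w = 0 → ∃ c : Fin m → Cᵐᵒᵖ, ∑ j, c j • v j = w ∧
      ∀ t, r (fun j => ε (unop (c j)) t) = F w t := fun w hw => by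
    obtain ⟨c, hc⟩ := hgen w hw
    refine ⟨c, hc, fun t => ?_⟩
    rw [hr, ← hc, hFsum]
    exact Finset.sum_congr rfl fun j _ => (hFs _ _ _).symm
  obtain ⟨s, hs⟩ := tilt_section hh T hT r (fun f hf => by
    let w : Fin n → Cᵐᵒᵖ := fun i => op (ε.symm (LinearMap.proj i ∘ₗ f))
    have hw : ∀ t, F w t = f t := fun t => by
      funext i
      simp [F, w]
    have hw0 : α w = 0 := by
      apply MulOpposite.unop_injective
      apply ε.injective
      ext t
      rw [← hΦ, hw]
      obtain ⟨u, hu⟩ := hf t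
      rw [← hu, hΦr]; simp
    obtain ⟨c, -, hc⟩ := hfac' w hw0
    refine ⟨LinearMap.pi fun j => ε (unop (c j)), fun t => ?_⟩
    rw [← hw, ← hc]; rfl)
  have hrg : ∀ (w : LinearMap.ker α) t, F w.1 t ∈ LinearMap.range r := fun w t => by
    obtain ⟨c, -, hc⟩ := hfac' w.1 w.2
    exact ⟨_, hc t⟩
  let G : LinearMap.ker α → (T →ₗ[R] LinearMap.range r) := fun w =>
    LinearMap.codRestrict (LinearMap.range r) (F w.1) (hrg w)
  have hG : ∀ w t, (G w t).1 = F w.1 t := fun _ _ => rfl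
  let S : LinearMap.ker α →ₗ[Cᵐᵒᵖ] (Fin m → Cᵐᵒᵖ) :=
    { toFun := fun w j => op (ε.symm (LinearMap.proj j ∘ₗ s ∘ₗ G w))
      map_add' := fun w w' => by
        funext j
        apply MulOpposite.unop_injective
        apply ε.injective
        ext t
        have : G (w + w') t = G w t + G w' t := by
          apply Subtype.ext
          show F (w.1 + w'.1) t = F w.1 t + F w'.1 t
          rw [hFa]; rfl
        simp [this]
      map_smul' := fun c w => by
        funext j
        apply MulOpposite.unop_injective
        apply ε.injective
        ext t
        have : G (c • w) t = G w (ε (unop c) t) := Subtype.ext (hFs c w.1 t)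
        simp [this] }
  let Rr : (Fin m → Cᵐᵒᵖ) →ₗ[Cᵐᵒᵖ] LinearMap.ker α :=
    LinearMap.codRestrict (LinearMap.ker α) (∑ j, (LinearMap.proj j).smulRight (v j))
      (fun c => by simp [hvk])
  refine Module.Projective.of_split S Rr ?_
  ext w : 1
  apply Subtype.ext
  have hinj : ∀ w w', (∀ t, F w t = F w' t) → w = w' := fun w w' h => by
    funext i
    apply MulOpposite.unop_injective
    apply ε.injective
    ext t
    exact congrFun (h t) i
  apply hinj
  intro t
  have e1 : (Rr (S w)).1 = ∑ j, S w j • v j := by simp [Rr]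
  show F (Rr (S w)).1 t = F w.1 t
  rw [e1, hFsum]
  have e2 := hs (G w t)
  rw [hr, hG] at e2
  rw [← e2]
  refine Finset.sum_congr rfl fun j _ => ?_
  rw [hFs]
  simp [S]

/-- quotient of injectives by injectives with two-step kernel are injective -/
lemma quot_injective [IsNoetherianRing R]
    (hker : ∀ (n : ℕ) (α : (Fin n → R) →ₗ[R] R), Module.Projective R (LinearMap.ker α))
    {I J V : Type} [AddCommGroup I] [AddCommGroup J] [AddCommGroup V] [Module R I] [Module R J]
    [Module R V] (hI : Module.Injective R I) (hJ : Module.Injective R J)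
    (j : I →ₗ[R] J) (p : J →ₗ[R] V) (hp : Function.Surjective p)
    (hex : ∀ x, p x = 0 ↔ ∃ y, j y = x) : Module.Injective R V := by
  apply Module.Baer.injective
  intro 𝔞 g
  obtain ⟨n, a, ha⟩ := Submodule.fg_iff_exists_fin_generating_family.1
    (IsNoetherian.noetherian 𝔞)
  have hak : ∀ i, a i ∈ 𝔞 := fun i => by rw [← ha]; exact Submodule.subset_span ⟨i, rfl⟩
  let α : (Fin n → R) →ₗ[R] R := ∑ i, (LinearMap.proj i).smulRight (a i)
  have hα : ∀ w, α w = ∑ i, w i • a i := fun w => by simp [α]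
  let α' : (Fin n → R) →ₗ[R] 𝔞 := LinearMap.codRestrict 𝔞 α (fun w => by
    rw [hα]; exact Submodule.sum_mem _ fun i _ => Submodule.smul_mem _ _ (hak i))
  have hα' : Function.Surjective α' := by
    rintro ⟨x, hx⟩
    have hx' := hx
    rw [← ha] at hx'
    obtain ⟨c, hc⟩ := (Submodule.mem_span_range_iff_exists_fun _).1 hx'
    exact ⟨c, Subtype.ext ((hα c).trans hc)⟩
  obtain ⟨l, hl⟩ := proj_lift (inferInstance : Module.Projective R (Fin n → R)) p hp (g ∘ₗ α')
  obtain ⟨b, hb⟩ := proj_lift' (hker n α) j (l ∘ₗ (LinearMap.ker α).subtype) (fun w => by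
    rw [← hex]
    have : α' w.1 = 0 := Subtype.ext w.2
    rw [LinearMap.comp_apply, hl, LinearMap.comp_apply]
    show g (α' w.1) = 0
    rw [this, map_zero])
  obtain ⟨b', hb'⟩ := inj_ext hI (LinearMap.ker α).subtype Subtype.val_injective b
  obtain ⟨l', hl'⟩ := factor_surj (l - j ∘ₗ b') α' hα' (fun w hw => by
    have h0 : α w = 0 := congrArg Subtype.val hw
    have e1 : b' w = b ⟨w, h0⟩ := hb' ⟨w, h0⟩
    have e2 : j (b ⟨w, h0⟩) = l w := hb ⟨w, h0⟩
    rw [LinearMap.sub_apply, LinearMap.comp_apply, e1, e2, sub_self])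
  obtain ⟨h, hh⟩ := inj_ext hJ 𝔞.subtype Subtype.val_injective l'
  refine ⟨p ∘ₗ h, fun x hx => ?_⟩
  obtain ⟨w, hw⟩ := hα' ⟨x, hx⟩
  have e1 : h x = l' ⟨x, hx⟩ := hh ⟨x, hx⟩
  have e3 : p (j (b' w)) = 0 := (hex _).2 ⟨_, rfl⟩
  rw [LinearMap.comp_apply, e1, ← hw, hl', LinearMap.sub_apply, map_sub, hl, LinearMap.comp_apply,
    LinearMap.comp_apply, e3, sub_zero]

end TiltSide

open CategoryTheory MulOpposite

section InjSide
variable {k C : Type} [Field k] [Ring C] [Algebra k C]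

lemma k_ext {K P : Type} [AddCommGroup K] [AddCommGroup P] [Module k K] [Module k P]
    (i : K →ₗ[k] P) (g : K →ₗ[k] k) (h : ∀ a, i a = 0 → g a = 0) :
    ∃ h : P →ₗ[k] k, ∀ a, h (i a) = g a := by
  obtain ⟨g', hg'⟩ := factor_surj g i.rangeRestrict i.surjective_rangeRestrict
    (fun a ha => h a (congrArg Subtype.val ha))
  obtain ⟨h, hh⟩ := LinearMap.exists_extend g'
  exact ⟨h, fun a => by rw [← hg']; exact LinearMap.congr_fun hh (i.rangeRestrict a)⟩

section
variable {P : Type} [AddCommGroup P] [Module k P] [Module C P] [IsScalarTower k C P]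

lemma dbl_ann [FiniteDimensional k P] (K : Submodule Cᵐᵒᵖ (KD k P)) (l : KD k P)
    (h : ∀ x, (∀ ξ ∈ K, ξ x = 0) → l x = 0) : l ∈ K := by
  let Kk : Submodule k (Module.Dual k P) :=
    { carrier := {ξ | (ξ : KD k P) ∈ K}
      add_mem' := fun ha hb => K.add_mem ha hb
      zero_mem' := K.zero_mem
      smul_mem' := fun c ξ hξ => (K.restrictScalars k).smul_mem c hξ }
  have e := Subspace.dualCoannihilator_dualAnnihilator_eq (W := Kk)
  let l' : Module.Dual k P := l
  have h' : l' ∈ Kk.dualCoannihilator.dualAnnihilator :=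
    (Submodule.mem_dualAnnihilator _).2 fun x hx =>
      h x ((Submodule.mem_dualCoannihilator _).1 hx)
  rw [e] at h'
  exact h'

lemma sup_top (N L : Submodule C P)
    (h : ∀ ξ : KD k P, (∀ x ∈ N, ξ x = 0) → (∀ x ∈ L, ξ x = 0) → ξ = 0) : N ⊔ L = ⊤ := by
  by_contra hne
  obtain ⟨x, hx⟩ : ∃ x, x ∉ N ⊔ L := by
    by_contra hh
    push Not at hh
    exact hne (eq_top_iff.2 fun x _ => hh x)
  obtain ⟨ξ, h1, h2⟩ := Submodule.exists_dual_map_eq_bot_of_notMem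
    (p := (N ⊔ L).restrictScalars k) (x := x) hx inferInstance
  apply h1
  have h3 : ∀ y ∈ N ⊔ L, ξ y = 0 := fun y hy => by
    have : ξ y ∈ ((N ⊔ L).restrictScalars k).map ξ := ⟨y, hy, rfl⟩
    rw [h2] at this
    exact this
  have := h ξ (fun y hy => h3 y (Submodule.mem_sup_left hy))
    (fun y hy => h3 y (Submodule.mem_sup_right hy))
  exact congrArg (fun z : KD k P => z x) this

/-- annihilator of a set of functionals -/
def annK (K : Submodule Cᵐᵒᵖ (KD k P)) : Submodule C P where
  carrier := {x | ∀ ξ ∈ K, ξ x = 0}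
  add_mem' ha hb ξ hξ := by rw [map_add, ha ξ hξ, hb ξ hξ, add_zero]
  zero_mem' ξ _ := map_zero ξ
  smul_mem' c x hx ξ hξ := by
    rw [← KD.op_smul_ap]; exact hx _ (K.smul_mem _ hξ)

end

lemma fd_of_finite (k R : Type) [Field k] [Ring R] [Algebra k R] [FiniteDimensional k R]
    (M : Type) [AddCommGroup M] [Module R M] [Module k M] [IsScalarTower k R M]
    [Module.Finite R M] : FiniteDimensional k M := Module.Finite.trans R M

lemma fd_op (k C : Type) [Field k] [Ring C] [Algebra k C] [FiniteDimensional k C] :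
    FiniteDimensional k Cᵐᵒᵖ := Module.Finite.equiv (MulOpposite.opLinearEquiv k)

lemma exists_injEnv (k : Type) {C : Type} [Field k] [Ring C] [Algebra k C]
    [FiniteDimensional k C] (M : Mdl Cᵐᵒᵖ) [Module.Finite Cᵐᵒᵖ M] :
    ∃ (I : Mdl Cᵐᵒᵖ) (f : M →ₗ[Cᵐᵒᵖ] I), IsInjEnv Cᵐᵒᵖ f ∧ Module.Finite Cᵐᵒᵖ I := by
  have := fd_op k C
  have : IsArtinianRing C := IsArtinianRing.of_finite k C
  let := kmod k Cᵐᵒᵖ M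
  have := kmod_tower k Cᵐᵒᵖ M
  have : FiniteDimensional k M := fd_of_finite k Cᵐᵒᵖ M
  have : Module.Finite C (KD' k M) := KD'.finite
  obtain ⟨P, d, ⟨hP, hd, hmin⟩, hfin⟩ := exists_projCover (ModuleCat.of C (KD' k M))
  let := kmod k C P
  have := kmod_tower k C P
  have : FiniteDimensional k P := fd_of_finite k C P
  let d' : P → KD' k M := fun x => d x
  have hd' : ∀ (c : C) x m, d' (c • x) m = d' x (op c • m) := fun c x m => by
    have : d (c • x) = c • d x := map_smul _ _ _
    exact congrArg (fun z : KD' k M => z m) this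
  have hda : ∀ x y m, d' (x + y) m = d' x m + d' y m := fun x y m =>
    congrArg (fun z : KD' k M => z m) (map_add d x y)
  have hdk : ∀ (c : k) x m, d' (c • x) m = c * d' x m := fun c x m => by
    refine (hd' (algebraMap k C c) x m).trans ?_
    exact KD'.alg_smul_ap (C := C) c (d' x) m
  let f : M →ₗ[Cᵐᵒᵖ] KD k P :=
    { toFun := fun m => ({ toFun := fun x => d' x m, map_add' := fun x y => hda x y m
                           map_smul' := fun c x => hdk c x m } : P →ₗ[k] k)
      map_add' := fun m m' => KD.ext' fun x => map_add (d' x) m m'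
      map_smul' := fun c m => KD.ext' fun x => (hd' (unop c) x m).symm }
  have hf : ∀ m x, f m x = d' x m := fun _ _ => rfl
  have hsep : Function.Injective f := by
    rw [← LinearMap.ker_eq_bot, LinearMap.ker_eq_bot']
    intro m hm
    rw [← Module.forall_dual_apply_eq_zero_iff k m]
    intro l
    obtain ⟨x, hx⟩ := hd (l : KD' k M)
    have h1 : f m x = 0 := by rw [hm]; rfl
    rw [hf] at h1
    have h2 : d' x = l := hx
    rw [h2] at h1
    exact h1
  have : FiniteDimensional k (KD k P) := inferInstance
  refine ⟨ModuleCat.of Cᵐᵒᵖ (KD k P), f, ⟨KD_injective hP, hsep, ?_⟩,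
    Module.Finite.of_restrictScalars_finite k Cᵐᵒᵖ _⟩
  intro K hK
  have hN : annK (k := k) (C := C) (P := P) K = ⊤ := by
    apply hmin
    apply sup_top (k := k)
    intro ξ h1 h2
    have hξK : ξ ∈ K := dbl_ann (C := C) K ξ h1
    -- ξ factors through d
    obtain ⟨l, hl⟩ := factor_surj (R := k) (P := P) (X := (M →ₗ[k] k)) (Z := k) ξ
      { toFun := fun x => d' x, map_add' := fun x y => LinearMap.ext fun m => hda x y m
        map_smul' := fun c x => LinearMap.ext fun m => hdk c x m }
      (fun l => hd l) (fun x hx => h2 x hx)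
    obtain ⟨m, hm⟩ := (Module.evalEquiv k M).surjective l
    have h3 : f m = ξ := KD.ext' fun x => by
      rw [hf]
      refine Eq.trans ?_ (hl x)
      rw [← hm]; rfl
    have h4 : ξ ∈ K ⊓ LinearMap.range f := ⟨hξK, m, h3⟩
    rw [hK] at h4
    exact h4
  rw [eq_bot_iff]
  intro ξ hξ
  refine KD.ext' (k := k) (Q := P) fun x => ?_
  have : x ∈ annK (k := k) (C := C) (P := P) K := hN ▸ trivial
  exact this ξ hξ

lemma exists_tauInvCosyz (k : Type) {C : Type} [Field k] [Ring C] [Algebra k C]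
    [FiniteDimensional k C] (M : Mdl Cᵐᵒᵖ) [Module.Finite Cᵐᵒᵖ M] :
    ∃ W, IsTauInvCosyz k C M W := by
  have := fd_op k C
  have : IsArtinianRing C := IsArtinianRing.of_finite k C
  obtain ⟨I, f, hf, hI⟩ := exists_injEnv k M
  let V := I ⧸ LinearMap.range f
  let := kmod k Cᵐᵒᵖ V
  have := kmod_tower k Cᵐᵒᵖ V
  have : FiniteDimensional k V := fd_of_finite k Cᵐᵒᵖ V
  have : Module.Finite C (KD' k V) := KD'.finite
  obtain ⟨Q1, Q0, d1, d0, hp⟩ := exists_minPres (ModuleCat.of C (KD' k V))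
  let S : Submodule Cᵐᵒᵖ (Q1 →ₗ[C] C) :=
    { carrier := {g | ∃ γ : Q0 →ₗ[C] C, g = γ.comp d1}
      add_mem' := by
        rintro _ _ ⟨f, rfl⟩ ⟨f', rfl⟩
        exact ⟨f + f', by ext; simp⟩
      zero_mem' := ⟨0, by ext; simp⟩
      smul_mem' := by
        rintro c _ ⟨f, rfl⟩
        exact ⟨c • f, by ext; simp⟩ }
  refine ⟨ModuleCat.of Cᵐᵒᵖ ((Q1 →ₗ[C] C) ⧸ S), ModuleCat.of Cᵐᵒᵖ V,
    ⟨I, f, hf, ⟨LinearEquiv.refl _ _⟩⟩, ModuleCat.of C (KD' k V), ?_, Q1, Q0, d1, d0, hp, S.mkQ,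
    S.mkQ_surjective, fun g => Submodule.Quotient.mk_eq_zero S⟩
  refine ⟨fun v ξ => (show KD' k V from ξ) (show V from v), fun v v' ξ => ?_, fun v ξ ξ' => rfl,
    fun c v ξ => ?_, fun a v ξ => rfl, fun v hv => ?_, fun ξ hξ => ?_⟩
  · exact map_add (show KD' k V from ξ) _ _
  · exact KD'.alg_smul_ap (C := C) c _ _
  · exact (Module.forall_dual_apply_eq_zero_iff k (show V from v)).1 hv
  · exact KD'.ext' hξ


structure WData (k C : Type) [Field k] [Ring C] [Algebra k C] (M W : Mdl Cᵐᵒᵖ) where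
  I : Type
  Q1 : Type
  Q0 : Type
  [i1 : AddCommGroup I]
  [i2 : Module Cᵐᵒᵖ I]
  [i3 : AddCommGroup Q1]
  [i4 : Module C Q1]
  [i5 : Module k Q1]
  [i6 : IsScalarTower k C Q1]
  [i7 : AddCommGroup Q0]
  [i8 : Module C Q0]
  [i9 : Module k Q0]
  [i10 : IsScalarTower k C Q0]
  f : M →ₗ[Cᵐᵒᵖ] I
  hf : Function.Injective f
  hI : Module.Injective Cᵐᵒᵖ I
  hQ1 : Module.Projective C Q1
  hQ0 : Module.Projective C Q0
  hQf : Module.Finite C Q1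
  dQ : Q1 →ₗ[C] Q0
  hdQ : Function.Injective dQ
  j : I →ₗ[Cᵐᵒᵖ] KD k Q0
  hj : ∀ i, j i = 0 ↔ ∃ m, f m = i
  hjr : ∀ ξ : KD k Q0, (∃ i, j i = ξ) ↔ ∀ x, ξ (dQ x) = 0
  q : (Q1 →ₗ[C] C) →ₗ[Cᵐᵒᵖ] W
  hq : Function.Surjective q
  hqk : ∀ g : Q1 →ₗ[C] C, q g = 0 ↔ ∃ γ : Q0 →ₗ[C] C, g = γ.comp dQ

lemma exists_wdata [FiniteDimensional k C]
    (hker : ∀ (n : ℕ) (α : (Fin n → Cᵐᵒᵖ) →ₗ[Cᵐᵒᵖ] Cᵐᵒᵖ),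
      Module.Projective Cᵐᵒᵖ (LinearMap.ker α))
    (M : Mdl Cᵐᵒᵖ) [Module.Finite Cᵐᵒᵖ M] (W) (hW : IsTauInvCosyz k C M W) :
    Nonempty (WData k C M W) := by
  have := fd_op k C
  have : IsNoetherianRing C := IsNoetherianRing.of_finite k C
  have : IsNoetherianRing Cᵐᵒᵖ := IsNoetherianRing.of_finite k Cᵐᵒᵖ
  obtain ⟨V, ⟨I, f, ⟨hI, hf, hess⟩, ⟨e⟩⟩, DV, ⟨φ, a1, a2, a3, a4, a5, a6⟩, Q1, Q0, dQ, d0, hp,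
    q, hq, hqk⟩ := hW
  have hIfin : Module.Finite Cᵐᵒᵖ I := by
    obtain ⟨I', f', ⟨hI', hf', -⟩, hfin⟩ := exists_injEnv k M
    obtain ⟨h, hh⟩ := inj_ext hI' f hf f'
    have hinj : LinearMap.ker h = ⊥ := hess _ (by
      rw [eq_bot_iff]
      rintro _ ⟨h1, m, rfl⟩
      have h2 : h (f m) = 0 := h1
      rw [hh] at h2
      have : m = 0 := hf' (by rw [h2, map_zero])
      rw [this, map_zero]; exact Submodule.zero_mem _)
    exact Module.Finite.of_injective h (LinearMap.ker_eq_bot.1 hinj)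
  have hVfin : Module.Finite Cᵐᵒᵖ V := Module.Finite.equiv e.symm
  let := kmod k Cᵐᵒᵖ V
  have := kmod_tower k Cᵐᵒᵖ V
  have hVfd : FiniteDimensional k V := fd_of_finite k Cᵐᵒᵖ V
  let := kmod k C DV
  have := kmod_tower k C DV
  obtain ⟨-, hrep, -, hDV⟩ := pair_rep (k := k) (N := V) (M := DV) (Or.inl hVfd) φ a1 a2 a3
    (fun c n m => (a4 (algebraMap k C c) n m).trans (a3 c n m)) a5 a6
  have : Module.Finite C DV := Module.Finite.of_restrictScalars_finite k C _
  obtain ⟨hf0, hf1⟩ := hp.finite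
  obtain ⟨⟨hQ0, hd0, -⟩, hQ1, hex, hmin⟩ := hp
  let := kmod k C Q0
  have := kmod_tower k C Q0
  let := kmod k C Q1
  have := kmod_tower k C Q1
  have : FiniteDimensional k Q1 := fd_of_finite k C Q1
  have hz : ∀ x, d0 (dQ x) = 0 := fun x => by
    have : dQ x ∈ LinearMap.range dQ := ⟨x, rfl⟩
    rw [hex] at this
    exact this
  have hz' : ∀ y, d0 y = 0 → ∃ x, dQ x = y := fun y hy => by
    have : y ∈ LinearMap.ker d0 := hy
    rw [← hex] at this
    exact this
  let v : I →ₗ[Cᵐᵒᵖ] V := e.symm.toLinearMap ∘ₗ (LinearMap.range f).mkQ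
  have hv : Function.Surjective v := e.symm.surjective.comp (LinearMap.range f).mkQ_surjective
  have hvk : ∀ i, v i = 0 ↔ ∃ m, f m = i := fun i => by
    show e.symm ((LinearMap.range f).mkQ i) = 0 ↔ _
    rw [LinearEquiv.map_eq_zero_iff]
    exact Submodule.Quotient.mk_eq_zero _
  let j : I →ₗ[Cᵐᵒᵖ] KD k Q0 :=
    { toFun := fun i => ({ toFun := fun x => φ (v i) (d0 x)
                           map_add' := fun x y => by rw [map_add, a2]
                           map_smul' := fun c x => by
                             refine Eq.trans ?_ (a3 c _ _)
                             rw [← map_smul]; rfl } : Q0 →ₗ[k] k)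
      map_add' := fun i i' => KD.ext' fun x => by
        show φ (v (i + i')) (d0 x) = φ (v i) (d0 x) + φ (v i') (d0 x)
        rw [map_add, a1]
      map_smul' := fun c i => KD.ext' fun x => by
        show φ (v (c • i)) (d0 x) = φ (v i) (d0 (unop c • x))
        rw [map_smul, map_smul, ← a4]; rfl }
  have hjap : ∀ i x, j i x = φ (v i) (d0 x) := fun _ _ => rfl
  have hj : ∀ i, j i = 0 ↔ ∃ m, f m = i := fun i => by
    rw [← hvk]
    constructor
    · intro h
      apply a5
      intro m
      obtain ⟨x, rfl⟩ := hd0 m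
      rw [← hjap, h]; rfl
    · intro h
      ext x
      rw [hjap, h]
      have := a1 0 0 (d0 x)
      rw [add_zero] at this
      exact left_eq_add.1 this
  have hjr : ∀ ξ : KD k Q0, (∃ i, j i = ξ) ↔ ∀ x, ξ (dQ x) = 0 := fun ξ => by
    constructor
    · rintro ⟨i, rfl⟩ x
      rw [hjap, hz]
      have := a2 (v i) 0 0
      rw [add_zero] at this
      exact left_eq_add.1 this
    · intro h
      obtain ⟨l, hl⟩ := factor_surj (R := k) (P := Q0) (X := DV) (Z := k) ξ
        (d0.restrictScalars k) hd0 (fun a ha => by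
          obtain ⟨x, rfl⟩ := hz' a ha
          exact h x)
      obtain ⟨n, hn⟩ := hrep l
      obtain ⟨i, rfl⟩ := hv n
      exact ⟨i, KD.ext' fun x => by rw [hjap, ← hn]; exact hl x⟩
  -- injectivity of dQ
  let V' : Submodule Cᵐᵒᵖ (KD k Q1) :=
    { carrier := {η | ∀ x, dQ x = 0 → η x = 0}
      add_mem' := fun {a b} ha hb x hx => by rw [KD.add_ap, ha x hx, hb x hx, add_zero]
      zero_mem' := fun x _ => rfl
      smul_mem' := fun c η hη x hx => by
        show η (unop c • x) = 0
        apply hη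
        rw [map_smul, hx, smul_zero] }
  let res : KD k Q0 →ₗ[Cᵐᵒᵖ] V' := LinearMap.codRestrict V'
    { toFun := fun ξ => ((show Q0 →ₗ[k] k from ξ) ∘ₗ (dQ.restrictScalars k) : Q1 →ₗ[k] k)
      map_add' := fun ξ ξ' => rfl
      map_smul' := fun c ξ => KD.ext' fun x => by
        show ξ (unop c • dQ x) = ξ (dQ (unop c • x))
        rw [map_smul dQ] }
    (fun ξ x hx => by
      show ξ (dQ x) = 0
      rw [hx, map_zero])
  have hres : ∀ ξ x, (res ξ).1 x = ξ (dQ x) := fun _ _ => rfl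
  have hV' : Module.Injective Cᵐᵒᵖ V' := quot_injective (fun n α => hker n α) hI
    (KD_injective hQ0) j res (by
      rintro ⟨η, hη⟩
      obtain ⟨h, hh⟩ := k_ext (dQ.restrictScalars k) (show Q1 →ₗ[k] k from η) hη
      exact ⟨h, Subtype.ext (KD.ext' hh)⟩) (fun ξ => by
      rw [hjr]
      constructor
      · intro h x
        rw [← hres, h]; rfl
      · intro h
        apply Subtype.ext
        ext x
        exact h x)
  obtain ⟨r, hr⟩ := inj_ext hV' V'.subtype Subtype.val_injective LinearMap.id
  have hN : annK (LinearMap.ker r) = ⊤ := by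
    apply hmin
    apply sup_top (k := k)
    intro ξ h1 h2
    have hξ : r ξ = 0 := dbl_ann (C := C) (LinearMap.ker r) ξ h1
    have hξ' : ξ ∈ V' := h2
    have := hr ⟨ξ, hξ'⟩
    have h3 : r ξ = ⟨ξ, hξ'⟩ := this
    rw [hξ] at h3
    exact (congrArg Subtype.val h3).symm
  have hrinj : ∀ ξ, r ξ = 0 → ξ = 0 := fun ξ hξ => by
    ext x
    have : x ∈ annK (LinearMap.ker r) := hN ▸ trivial
    exact this ξ hξ
  have hall : ∀ ξ : KD k Q1, ξ ∈ V' := fun ξ => by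
    have h1 : r (r ξ).1 = r ξ := hr (r ξ)
    have h2 : (r ξ).1 - ξ = 0 := hrinj _ (by rw [map_sub, h1, sub_self])
    rw [← sub_eq_zero.1 h2]
    exact (r ξ).2
  have hdQ : Function.Injective dQ := by
    rw [← LinearMap.ker_eq_bot, LinearMap.ker_eq_bot']
    intro x hx
    rw [← Module.forall_dual_apply_eq_zero_iff k x]
    intro l
    exact hall l x hx
  exact ⟨{ I := I, Q1 := Q1, Q0 := Q0, f := f, hf := hf, hI := hI, hQ1 := hQ1, hQ0 := hQ0
           hQf := hf1, dQ := dQ, hdQ := hdQ, j := j, hj := hj, hjr := hjr, q := q, hq := hq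
           hqk := hqk }⟩

end InjSide

open CategoryTheory MulOpposite

section Zigzag

/-- The data entering the definition of the relation bimodule. -/
structure EData (k C E : Type) [Field k] [Ring C] [Algebra k C] [AddCommGroup E] [Module C E]
    [Module Cᵐᵒᵖ E] where
  DC : Type
  P2 : Type
  P1 : Type
  P0 : Type
  [i1 : AddCommGroup DC]
  [i2 : Module Cᵐᵒᵖ DC]
  [i3 : AddCommGroup P2]
  [i4 : Module Cᵐᵒᵖ P2]
  [i5 : AddCommGroup P1]
  [i6 : Module Cᵐᵒᵖ P1]
  [i7 : AddCommGroup P0]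
  [i8 : Module Cᵐᵒᵖ P0]
  φ : DC → C → k
  b1 : ∀ n n' m, φ (n + n') m = φ n m + φ n' m
  b2 : ∀ n m m', φ n (m + m') = φ n m + φ n m'
  b3 : ∀ (c : k) n m, φ n ((algebraMap k C c) * m) = c * φ n m
  b4 : ∀ (a : C) n m, φ (op a • n) m = φ n (a * m)
  b5 : ∀ n, (∀ m, φ n m = 0) → n = 0
  b6 : ∀ m, (∀ n, φ n m = 0) → m = 0
  d2 : P2 →ₗ[Cᵐᵒᵖ] P1
  d1 : P1 →ₗ[Cᵐᵒᵖ] P0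
  d0 : P0 →ₗ[Cᵐᵒᵖ] DC
  hP2 : Module.Projective Cᵐᵒᵖ P2
  hP1 : Module.Projective Cᵐᵒᵖ P1
  hP0 : Module.Projective Cᵐᵒᵖ P0
  hd2 : Function.Injective d2
  hd0 : Function.Surjective d0
  ex1 : ∀ p, d1 p = 0 ↔ ∃ x, d2 x = p
  ex0 : ∀ p, d0 p = 0 ↔ ∃ x, d1 x = p
  q : (P2 →ₗ[Cᵐᵒᵖ] C) →ₗ[C] E
  hq : Function.Surjective q
  hqk : ∀ g : P2 →ₗ[Cᵐᵒᵖ] C, q g = 0 ↔ ∃ f : P1 →ₗ[Cᵐᵒᵖ] C, g = f.comp d2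
  hl : ∀ c : C, ∃ (μ : DC →ₗ[Cᵐᵒᵖ] DC) (f0 : P0 →ₗ[Cᵐᵒᵖ] P0)
            (f1 : P1 →ₗ[Cᵐᵒᵖ] P1) (f2 : P2 →ₗ[Cᵐᵒᵖ] P2),
          (∀ n x, φ (μ n) x = φ n (x * c)) ∧
          d0.comp f0 = μ.comp d0 ∧
          d1.comp f1 = f0.comp d1 ∧
          d2.comp f2 = f1.comp d2 ∧
          ∀ g : P2 →ₗ[Cᵐᵒᵖ] C, q (g.comp f2) = op c • q g

attribute [instance] EData.i1 EData.i2 EData.i3 EData.i4 EData.i5 EData.i6 EData.i7 EData.i8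
attribute [instance] WData.i1 WData.i2 WData.i3 WData.i4 WData.i5 WData.i6 WData.i7 WData.i8
  WData.i9 WData.i10

lemma exists_edata {k C E : Type} [Field k] [Ring C] [Algebra k C] [AddCommGroup E] [Module C E]
    [Module Cᵐᵒᵖ E] (h : IsRelExt k C E) : Nonempty (EData k C E) := by
  obtain ⟨DC, φ, b1, b2, b3, b4, b5, b6, P2, P1, P0, d2, d1, d0, hP2, hP1, hP0, hd2, hd0, e1, e0,
    q, hq, hqk, hl⟩ := h
  exact ⟨{ DC := DC, P2 := P2, P1 := P1, P0 := P0, φ := φ, b1 := b1, b2 := b2, b3 := b3, b4 := b4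
           b5 := b5, b6 := b6, d2 := d2, d1 := d1, d0 := d0, hP2 := hP2, hP1 := hP1, hP0 := hP0
           hd2 := hd2, hd0 := hd0, q := q, hq := hq, hqk := hqk, hl := hl
           ex1 := fun p => by
             rw [← LinearMap.mem_ker, ← e1]; rfl
           ex0 := fun p => by
             rw [← LinearMap.mem_ker, ← e0]; rfl }⟩

variable {k C E : Type} [Field k] [Ring C] [Algebra k C] [AddCommGroup E] [Module C E]
    [Module Cᵐᵒᵖ E] {M W : Mdl Cᵐᵒᵖ} (D : EData k C E) (w : WData k C M W)

/-- the zigzag correspondence -/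
def ZRel (g : w.Q1 →ₗ[C] C) (u : D.P2 →ₗ[Cᵐᵒᵖ] M) : Prop :=
  ∃ (a : D.P0 →ₗ[Cᵐᵒᵖ] KD k w.Q0) (b : D.P1 →ₗ[Cᵐᵒᵖ] w.I),
    (∀ p x, a p (w.dQ x) = D.φ (D.d0 p) (g x)) ∧ (∀ p, w.j (b p) = a (D.d1 p)) ∧
    ∀ p, w.f (u p) = b (D.d2 p)

lemma EData.φ0 (n : D.DC) : D.φ n 0 = 0 := by
  have := D.b2 n 0 0
  rw [add_zero] at this
  exact left_eq_add.1 this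

lemma EData.φ0' (x : C) : D.φ 0 x = 0 := by
  have := D.b1 0 0 x
  rw [add_zero] at this
  exact left_eq_add.1 this

lemma EData.φsub (n : D.DC) (x y : C) : D.φ n (x - y) = D.φ n x - D.φ n y := by
  rw [eq_sub_iff_add_eq, ← D.b2, sub_add_cancel]

lemma EData.d01 (p) : D.d0 (D.d1 p) = 0 := (D.ex0 _).2 ⟨p, rfl⟩
lemma EData.d12 (p) : D.d1 (D.d2 p) = 0 := (D.ex1 _).2 ⟨p, rfl⟩
lemma WData.jf (m) : w.j (w.f m) = 0 := (w.hj _).2 ⟨m, rfl⟩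

variable {D w}

lemma ZRel.add {g g' : w.Q1 →ₗ[C] C} {u u' : D.P2 →ₗ[Cᵐᵒᵖ] M} (h : ZRel D w g u)
    (h' : ZRel D w g' u') : ZRel D w (g + g') (u + u') := by
  obtain ⟨a, b, h1, h2, h3⟩ := h
  obtain ⟨a', b', h1', h2', h3'⟩ := h'
  refine ⟨a + a', b + b', fun p x => ?_, fun p => ?_, fun p => ?_⟩
  · rw [LinearMap.add_apply, KD.add_ap, h1, h1', LinearMap.add_apply, D.b2]
  · simp only [LinearMap.add_apply, map_add, h2, h2']
  · simp only [LinearMap.add_apply, map_add, h3, h3']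

lemma ZRel.sub {g g' : w.Q1 →ₗ[C] C} {u u' : D.P2 →ₗ[Cᵐᵒᵖ] M} (h : ZRel D w g u)
    (h' : ZRel D w g' u') : ZRel D w (g - g') (u - u') := by
  obtain ⟨a, b, h1, h2, h3⟩ := h
  obtain ⟨a', b', h1', h2', h3'⟩ := h'
  refine ⟨a - a', b - b', fun p x => ?_, fun p => ?_, fun p => ?_⟩
  · rw [LinearMap.sub_apply, KD.sub_ap, h1, h1', LinearMap.sub_apply, D.φsub]
  · simp only [LinearMap.sub_apply, map_sub, h2, h2']
  · simp only [LinearMap.sub_apply, map_sub, h3, h3']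

variable (D w)

/-- the map `P0 → D Q` induced by a map `Q → C` -/
def EData.toKD {Q : Type} [AddCommGroup Q] [Module k Q] [Module C Q] [IsScalarTower k C Q]
    (g : Q →ₗ[C] C) : D.P0 →ₗ[Cᵐᵒᵖ] KD k Q where
  toFun p := ({ toFun := fun x => D.φ (D.d0 p) (g x)
                map_add' := fun x y => by rw [map_add, D.b2]
                map_smul' := fun c x => by
                  have : c • x = (algebraMap k C c) • x := (algebraMap_smul C c x).symm
                  rw [this, map_smul, smul_eq_mul, D.b3]; rfl } : Q →ₗ[k] k)
  map_add' p p' := KD.ext' fun x => by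
    show D.φ (D.d0 (p + p')) (g x) = D.φ (D.d0 p) (g x) + D.φ (D.d0 p') (g x)
    rw [map_add, D.b1]
  map_smul' c p := KD.ext' fun x => by
    show D.φ (D.d0 (c • p)) (g x) = D.φ (D.d0 p) (g (unop c • x))
    rw [map_smul, map_smul, smul_eq_mul, ← D.b4, op_unop]

lemma EData.toKD_apply {Q : Type} [AddCommGroup Q] [Module k Q] [Module C Q]
    [IsScalarTower k C Q] (g : Q →ₗ[C] C) (p x) : D.toKD g p x = D.φ (D.d0 p) (g x) := rfl

/-- representability -/
lemma EData.rep [FiniteDimensional k C] {Q Q' : Type} [AddCommGroup Q] [Module k Q] [Module C Q]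
    [IsScalarTower k C Q] [AddCommGroup Q'] [Module C Q']
    (a : D.P0 →ₗ[Cᵐᵒᵖ] KD k Q) (δ : Q' →ₗ[C] Q)
    (h : ∀ p x, a (D.d1 p) (δ x) = 0) :
    ∃ g : Q' →ₗ[C] C, ∀ p x, a p (δ x) = D.φ (D.d0 p) (g x) := by
  let := kmod k Cᵐᵒᵖ D.DC
  let := kmod k Cᵐᵒᵖ D.P0
  have := kmod_tower k Cᵐᵒᵖ D.DC
  have := kmod_tower k Cᵐᵒᵖ D.P0
  have hrep := (pair_rep (k := k) (N := D.DC) (M := C) (Or.inr inferInstance) D.φ D.b1 D.b2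
    (fun c n m => by rw [Algebra.smul_def, D.b3])
    (fun c n m => (D.b4 (algebraMap k C c) n m).trans (D.b3 c n m)) D.b5 D.b6).1
  have key : ∀ x : Q', ∃ y : C, ∀ p, a p (δ x) = D.φ (D.d0 p) y := fun x => by
    obtain ⟨l, hl⟩ := factor_surj (R := k) (P := D.P0) (X := D.DC) (Z := k)
      { toFun := fun p => a p (δ x), map_add' := fun p p' => by rw [map_add]; rfl
        map_smul' := fun c p => by
          have : a (c • p) = c • a p := (a.restrictScalars k).map_smul c p
          rw [this]; rfl }
      (D.d0.restrictScalars k) D.hd0 (fun p hp => by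
        obtain ⟨p', rfl⟩ := (D.ex0 p).1 hp
        exact h p' x)
    obtain ⟨y, hy⟩ := hrep l
    exact ⟨y, fun p => by rw [← hy]; exact (hl p).symm⟩
  choose g hg using key
  have hinj : ∀ y y' : C, (∀ p, D.φ (D.d0 p) y = D.φ (D.d0 p) y') → y = y' := fun y y' hyy => by
    rw [← sub_eq_zero]
    apply D.b6
    intro n
    obtain ⟨p, rfl⟩ := D.hd0 n
    rw [D.φsub, hyy, sub_self]
  refine ⟨{ toFun := g, map_add' := fun x x' => hinj _ _ fun p => ?_
            map_smul' := fun c x => hinj _ _ fun p => ?_ }, fun p x => hg x p⟩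
  · rw [D.b2, ← hg, ← hg, ← hg, map_add, map_add]
  · rw [RingHom.id_apply, smul_eq_mul, ← D.b4, ← map_smul, ← hg, ← hg, map_smul δ, map_smul a]
    rfl

lemma zrel_left (g : w.Q1 →ₗ[C] C) : ∃ u, ZRel D w g u := by
  let res : KD k w.Q0 →ₗ[Cᵐᵒᵖ] KD k w.Q1 :=
    { toFun := fun ξ => ((show w.Q0 →ₗ[k] k from ξ) ∘ₗ (w.dQ.restrictScalars k) : w.Q1 →ₗ[k] k)
      map_add' := fun ξ ξ' => rfl
      map_smul' := fun c ξ => KD.ext' fun x => by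
        show ξ (unop c • w.dQ x) = ξ (w.dQ (unop c • x))
        rw [map_smul w.dQ] }
  have hres : ∀ ξ x, res ξ x = ξ (w.dQ x) := fun _ _ => rfl
  obtain ⟨a, ha⟩ := proj_lift D.hP0 res (fun η => by
    obtain ⟨h, hh⟩ := k_ext (w.dQ.restrictScalars k) (show w.Q1 →ₗ[k] k from η) (fun x hx => by
      have : x = 0 := w.hdQ (by rw [map_zero]; exact hx)
      rw [this]; exact map_zero η)
    exact ⟨h, KD.ext' hh⟩) (D.toKD g)
  have ha' : ∀ p x, a p (w.dQ x) = D.φ (D.d0 p) (g x) := fun p x => by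
    rw [← hres, ha]; rfl
  obtain ⟨b, hb⟩ := proj_lift' D.hP1 w.j (a ∘ₗ D.d1) (fun p => by
    rw [w.hjr]
    intro x
    rw [LinearMap.comp_apply, ha', D.d01, D.φ0'])
  obtain ⟨u, hu⟩ := factor_inj (b ∘ₗ D.d2) w.f w.hf (fun p => by
    rw [← w.hj, LinearMap.comp_apply, hb, LinearMap.comp_apply, D.d12, map_zero])
  exact ⟨u, a, b, ha', hb, hu⟩

lemma zrel_right [FiniteDimensional k C] (u : D.P2 →ₗ[Cᵐᵒᵖ] M) : ∃ g, ZRel D w g u := by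
  obtain ⟨b, hb⟩ := inj_ext w.hI D.d2 D.hd2 (w.f ∘ₗ u)
  obtain ⟨a, ha⟩ := inj_ext' (KD_injective w.hQ0) D.d1 (w.j ∘ₗ b) (fun p hp => by
    obtain ⟨x, rfl⟩ := (D.ex1 p).1 hp
    rw [LinearMap.comp_apply, hb, LinearMap.comp_apply, w.jf])
  obtain ⟨g, hg⟩ := D.rep a w.dQ (fun p x => by
    rw [ha]; exact (w.hjr _).1 ⟨_, rfl⟩ x)
  exact ⟨g, a, b, hg, fun p => (ha p).symm, fun p => (hb p).symm⟩

variable {D w}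

lemma ZRel.cob_right {g : w.Q1 →ₗ[C] C} {u : D.P2 →ₗ[Cᵐᵒᵖ] M} (h : ZRel D w g u)
    (γ : w.Q0 →ₗ[C] C) (hγ : g = γ.comp w.dQ) : ∃ u' : D.P1 →ₗ[Cᵐᵒᵖ] M, u = u'.comp D.d2 := by
  obtain ⟨a, b, h1, h2, h3⟩ := h
  obtain ⟨b', hb'⟩ := proj_lift' D.hP0 w.j (a - D.toKD γ) (fun p => by
    rw [w.hjr]
    intro x
    rw [LinearMap.sub_apply, KD.sub_ap, h1, D.toKD_apply, hγ, LinearMap.comp_apply, sub_self])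
  have h0 : ∀ p, D.toKD γ (D.d1 p) = 0 := fun p => KD.ext' fun x => by
    rw [D.toKD_apply, D.d01, D.φ0']; rfl
  obtain ⟨u', hu'⟩ := factor_inj (b - b' ∘ₗ D.d1) w.f w.hf (fun p => by
    rw [← w.hj, LinearMap.sub_apply, map_sub, h2, LinearMap.comp_apply, hb', LinearMap.sub_apply,
      h0, sub_zero, sub_self])
  refine ⟨u', LinearMap.ext fun p => w.hf ?_⟩
  rw [LinearMap.comp_apply, hu', h3, LinearMap.sub_apply, LinearMap.comp_apply, D.d12, map_zero,
    sub_zero]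

lemma ZRel.cob_left [FiniteDimensional k C] {g : w.Q1 →ₗ[C] C} {u : D.P2 →ₗ[Cᵐᵒᵖ] M}
    (h : ZRel D w g u)
    (u' : D.P1 →ₗ[Cᵐᵒᵖ] M) (hu' : u = u'.comp D.d2) : ∃ γ : w.Q0 →ₗ[C] C, g = γ.comp w.dQ := by
  obtain ⟨a, b, h1, h2, h3⟩ := h
  obtain ⟨b', hb'⟩ := inj_ext' w.hI D.d1 (b - w.f ∘ₗ u') (fun p hp => by
    obtain ⟨x, rfl⟩ := (D.ex1 p).1 hp
    rw [LinearMap.sub_apply, ← h3, hu', LinearMap.comp_apply, LinearMap.comp_apply, sub_self])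
  obtain ⟨γ, hγ⟩ := D.rep (a - w.j ∘ₗ b') LinearMap.id (fun p x => by
    rw [LinearMap.sub_apply, LinearMap.comp_apply, hb', LinearMap.sub_apply, map_sub, h2,
      LinearMap.comp_apply, w.jf, sub_zero, sub_self]; rfl)
  refine ⟨γ, LinearMap.ext fun x => ?_⟩
  rw [← sub_eq_zero]
  apply D.b6
  intro n
  obtain ⟨p, rfl⟩ := D.hd0 n
  have e1 : w.j (b' p) (w.dQ x) = 0 := (w.hjr _).1 ⟨_, rfl⟩ x
  have e2 := hγ p (w.dQ x)
  rw [LinearMap.id_apply, LinearMap.sub_apply, KD.sub_ap, LinearMap.comp_apply, e1, h1,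
    sub_zero] at e2
  rw [D.φsub, LinearMap.comp_apply, e2, sub_self]

lemma ZRel.lift {g : w.Q1 →ₗ[C] C} {u : D.P2 →ₗ[Cᵐᵒᵖ] M} (h : ZRel D w g u) (c : C)
    {μ : D.DC →ₗ[Cᵐᵒᵖ] D.DC} {f0 : D.P0 →ₗ[Cᵐᵒᵖ] D.P0}
    {f1 : D.P1 →ₗ[Cᵐᵒᵖ] D.P1} {f2 : D.P2 →ₗ[Cᵐᵒᵖ] D.P2}
    (hμ : ∀ n x, D.φ (μ n) x = D.φ n (x * c)) (h0 : D.d0.comp f0 = μ.comp D.d0)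
    (h1 : D.d1.comp f1 = f0.comp D.d1) (h2 : D.d2.comp f2 = f1.comp D.d2) :
    ZRel D w (op c • g) (u.comp f2) := by
  obtain ⟨a, b, e1, e2, e3⟩ := h
  refine ⟨a.comp f0, b.comp f1, fun p x => ?_, fun p => ?_, fun p => ?_⟩
  · have : D.d0 (f0 p) = μ (D.d0 p) := LinearMap.congr_fun h0 p
    rw [LinearMap.comp_apply, e1, this, hμ]; rfl
  · have : D.d1 (f1 p) = f0 (D.d1 p) := LinearMap.congr_fun h1 p
    rw [LinearMap.comp_apply, e2, this]; rfl
  · have : D.d2 (f2 p) = f1 (D.d2 p) := LinearMap.congr_fun h2 p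
    rw [LinearMap.comp_apply, e3, this]; rfl

variable (D w)

/-- maps out of `W` give maps on `Hom(P2, M)` -/
lemma H_of_h [FiniteDimensional k C] {X : Type} [AddCommGroup X] [Module Cᵐᵒᵖ X]
    (h : W →ₗ[Cᵐᵒᵖ] X) :
    ∃ H : (D.P2 →ₗ[Cᵐᵒᵖ] M) →+ X, ∀ g u, ZRel D w g u → H u = h (w.q g) := by
  choose G hG using zrel_right D w
  have key : ∀ g g' u, ZRel D w g u → ZRel D w g' u → h (w.q g) = h (w.q g') :=
    fun g g' u h1 h2 => by
    have h3 := h1.sub h2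
    obtain ⟨γ, hγ⟩ := h3.cob_left 0 (by rw [sub_self, LinearMap.zero_comp])
    have := (w.hqk (g - g')).2 ⟨γ, hγ⟩
    rw [map_sub, sub_eq_zero] at this
    rw [this]
  refine ⟨AddMonoidHom.mk' (fun u => h (w.q (G u))) (fun u u' => ?_), fun g u hgu =>
    key _ _ _ (hG u) hgu⟩
  rw [← map_add, ← map_add]
  exact key _ _ _ (hG _) ((hG u).add (hG u'))

lemma h_of_H {X : Type} [AddCommGroup X] [Module Cᵐᵒᵖ X]
    (H : (D.P2 →ₗ[Cᵐᵒᵖ] M) →+ X) (hH : ∀ u' : D.P1 →ₗ[Cᵐᵒᵖ] M, H (u'.comp D.d2) = 0)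
    (hHl : ∀ (c : C) (f2 : D.P2 →ₗ[Cᵐᵒᵖ] D.P2),
      (∀ g : D.P2 →ₗ[Cᵐᵒᵖ] C, D.q (g.comp f2) = op c • D.q g) →
      ∀ u : D.P2 →ₗ[Cᵐᵒᵖ] M, H (u.comp f2) = op c • H u) :
    ∃ h : W →ₗ[Cᵐᵒᵖ] X, ∀ g u, ZRel D w g u → h (w.q g) = H u := by
  choose U hU using zrel_left D w
  have hz : ∀ g u, ZRel D w g u → w.q g = 0 → H u = 0 := fun g u h0 hq0 => by
    obtain ⟨γ, hγ⟩ := (w.hqk g).1 hq0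
    obtain ⟨u', rfl⟩ := h0.cob_right γ hγ
    exact hH u'
  have key : ∀ g u u', ZRel D w g u → ZRel D w g u' → H u = H u' := fun g u u' h1 h2 => by
    have h3 := hz _ _ (h1.sub h2) (by rw [sub_self, map_zero])
    rwa [map_sub, sub_eq_zero] at h3
  let h0 : (w.Q1 →ₗ[C] C) →ₗ[Cᵐᵒᵖ] X :=
    { toFun := fun g => H (U g)
      map_add' := fun g g' => by
        rw [← map_add]; exact key _ _ _ (hU _) ((hU g).add (hU g'))
      map_smul' := fun c g => by
        obtain ⟨c, rfl⟩ := MulOpposite.op_surjective c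
        obtain ⟨μ, f0, f1, f2, l1, l2, l3, l4, l5⟩ := D.hl c
        rw [RingHom.id_apply, ← hHl c f2 l5]
        exact key _ _ _ (hU _) ((hU g).lift c l1 l2 l3 l4) }
  obtain ⟨h, hh⟩ := factor_surj h0 w.q w.hq (fun g hg => hz _ _ (hU g) hg)
  exact ⟨h, fun g u hgu => by rw [hh]; exact key _ _ _ (hU g) hgu⟩

end Zigzag

open CategoryTheory MulOpposite

section Final

/-- evaluation of coefficients on a family -/
def coefMap {C M : Type} [Ring C] [AddCommGroup M] [Module Cᵐᵒᵖ M] {n : ℕ} (m : Fin n → M) :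
    (Fin n → C) →ₗ[Cᵐᵒᵖ] M where
  toFun r := ∑ j, op (r j) • m j
  map_add' r s := by simp [add_smul, Finset.sum_add_distrib]
  map_smul' c r := by
    rw [RingHom.id_apply, Finset.smul_sum]
    refine Finset.sum_congr rfl fun j _ => ?_
    rw [smul_smul]; rfl

lemma coefMap_apply {C M : Type} [Ring C] [AddCommGroup M] [Module Cᵐᵒᵖ M] {n : ℕ}
    (m : Fin n → M) (r : Fin n → C) : coefMap m r = ∑ j, op (r j) • m j := rfl

lemma exists_gens (C M : Type) [Ring C] [AddCommGroup M] [Module Cᵐᵒᵖ M] [Module.Finite Cᵐᵒᵖ M] :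
    ∃ (n : ℕ) (m : Fin n → M), Function.Surjective (coefMap (C := C) m) := by
  obtain ⟨n, f, hf⟩ := Module.Finite.exists_fin' Cᵐᵒᵖ M
  refine ⟨n, fun i => f (Pi.single i 1), fun x => ?_⟩
  obtain ⟨v, rfl⟩ := hf x
  refine ⟨fun i => unop (v i), ?_⟩
  rw [coefMap_apply]
  simp only [op_unop, ← map_smul, ← map_sum]
  congr 1
  ext j
  simp [Finset.sum_apply, Pi.single_apply]

lemma sum_mulMap {C M P : Type} [Ring C] [AddCommGroup M] [Module Cᵐᵒᵖ M]
    [AddCommGroup P] [Module Cᵐᵒᵖ P] (hP : Module.Projective Cᵐᵒᵖ P) {n : ℕ} {m : Fin n → M}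
    (hm : Function.Surjective (coefMap (C := C) m)) (u : P →ₗ[Cᵐᵒᵖ] M) :
    ∃ g : Fin n → (P →ₗ[Cᵐᵒᵖ] C), u = ∑ j, mulMap (g j) (m j) := by
  obtain ⟨G, hG⟩ := proj_lift hP _ hm u
  refine ⟨fun j => (LinearMap.proj j).comp G, LinearMap.ext fun p => ?_⟩
  rw [← hG, coefMap_apply, LinearMap.sum_apply]
  rfl

lemma mulMap_comp {C M P P' : Type} [Ring C] [AddCommGroup M] [Module Cᵐᵒᵖ M]
    [AddCommGroup P] [Module Cᵐᵒᵖ P] [AddCommGroup P'] [Module Cᵐᵒᵖ P']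
    (g : P →ₗ[Cᵐᵒᵖ] C) (f : P' →ₗ[Cᵐᵒᵖ] P) (m : M) :
    (mulMap g m).comp f = mulMap (g.comp f) m := rfl

variable {k C E : Type} [Field k] [Ring C] [Algebra k C] [FiniteDimensional k C]
    [AddCommGroup E] [Module C E]
    [Module Cᵐᵒᵖ E]

lemma sum_comp' {P P' N : Type} [AddCommGroup P] [Module Cᵐᵒᵖ P] [AddCommGroup P']
    [Module Cᵐᵒᵖ P'] [AddCommGroup N] [Module Cᵐᵒᵖ N] {n : ℕ} (u : Fin n → (P →ₗ[Cᵐᵒᵖ] N))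
    (f : P' →ₗ[Cᵐᵒᵖ] P) : (∑ j, u j).comp f = ∑ j, (u j).comp f := by
  ext p; simp [LinearMap.sum_apply]

lemma hom_of_bal {M W : Mdl Cᵐᵒᵖ} (D : EData k C E) (w : WData k C M W)
    [Module.Finite Cᵐᵒᵖ M] (X : Mdl Cᵐᵒᵖ) (hb : BalZero C E M X) :
    HomZero Cᵐᵒᵖ W X := by
  intro h
  obtain ⟨H, hH⟩ := H_of_h D w h
  have hcob : ∀ u' : D.P1 →ₗ[Cᵐᵒᵖ] M, H (u'.comp D.d2) = 0 := fun u' => by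
    obtain ⟨g, hg⟩ := zrel_right D w (u'.comp D.d2)
    rw [hH _ _ hg, (w.hqk g).2 (hg.cob_left u' rfl), map_zero]
  choose s hs using D.hq
  have hwd : ∀ g (m : M), D.q g = 0 → H (mulMap g m) = 0 := fun g m hg => by
    obtain ⟨f, rfl⟩ := (D.hqk g).1 hg
    exact hcob (mulMap f m)
  have hadd : ∀ g g' (m : M), H (mulMap (g + g') m) = H (mulMap g m) + H (mulMap g' m) :=
    fun g g' m => by rw [mulMap_add_left, map_add]
  have hwd' : ∀ g g' (m : M), D.q g = D.q g' → H (mulMap g m) = H (mulMap g' m) :=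
    fun g g' m hgg => by
    have h1 := hadd (g - g') g' m
    rwa [sub_add_cancel, hwd (g - g') m (by rw [map_sub, hgg, sub_self]), zero_add] at h1
  have hβ := hb (fun m e => H (mulMap (s e) m))
    (fun m m' e => by rw [mulMap_add_right, map_add])
    (fun m e e' => by
      rw [← hadd]; exact hwd' _ _ _ (by rw [map_add, hs, hs, hs]))
    (fun c m e => by
      obtain ⟨μ, f0, f1, f2, l1, l2, l3, l4, l5⟩ := D.hl c
      obtain ⟨g, hg⟩ := zrel_right D w (mulMap (s e) m)
      have h1 := hH _ _ (hg.lift c l1 l2 l3 l4)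
      rw [mulMap_comp, map_smul, map_smul, ← hH _ _ hg] at h1
      rw [← h1]
      exact hwd' _ _ _ (by rw [l5, hs, hs]))
    (fun c m e => by
      rw [← mulMap_smul]
      exact hwd' _ _ _ (by rw [map_smul, hs, hs]))
  have hβ' : ∀ g (m : M), H (mulMap g m) = 0 := fun g m => by
    rw [← hβ m (D.q g)]; exact hwd' _ _ _ (hs _).symm
  obtain ⟨n, m, hm⟩ := exists_gens C M
  have hH0 : ∀ u, H u = 0 := fun u => by
    obtain ⟨g, rfl⟩ := sum_mulMap D.hP2 hm u
    rw [map_sum]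
    exact Finset.sum_eq_zero fun j _ => hβ' _ _
  ext x
  obtain ⟨g, rfl⟩ := w.hq x
  obtain ⟨u, hu⟩ := zrel_left D w g
  rw [← hH _ _ hu, hH0]; rfl

lemma finite_reg (k C : Type) [Field k] [Ring C] [Algebra k C] [FiniteDimensional k C] :
    Module.Finite Cᵐᵒᵖ C :=
  Module.Finite.of_surjective
    ({ toFun := fun x => unop x, map_add' := fun _ _ => rfl, map_smul' := fun _ _ => rfl } :
      Cᵐᵒᵖ →ₗ[Cᵐᵒᵖ] C) (fun x => ⟨op x, rfl⟩)

lemma bal_of_hom {M W : Mdl Cᵐᵒᵖ} (D : EData k C E) (w : WData k C M W)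
    [Module.Finite Cᵐᵒᵖ M] (X : Mdl Cᵐᵒᵖ) (hh : HomZero Cᵐᵒᵖ W X) :
    BalZero C E M X := by
  intro β h1 h2 h3 h4
  have := fd_op k C
  have : IsNoetherianRing Cᵐᵒᵖ := IsNoetherianRing.of_finite k Cᵐᵒᵖ
  have : Module.Finite Cᵐᵒᵖ C := finite_reg k C
  have h1s : ∀ {N : ℕ} (f : Fin N → M) e, β (∑ i, f i) e = ∑ i, β (f i) e := fun f e =>
    map_sum (AddMonoidHom.mk' (fun z => β z e) (fun a b => h1 a b e)) f _
  have h2s : ∀ {N : ℕ} (f : Fin N → E) m, β m (∑ i, f i) = ∑ i, β m (f i) := fun f m =>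
    map_sum (AddMonoidHom.mk' (fun z => β m z) (fun a b => h2 m a b)) f _
  have h10 : ∀ e, β 0 e = 0 := fun e => by simpa using h1 0 0 e
  have h20 : ∀ m, β m 0 = 0 := fun m => by simpa using h2 m 0 0
  obtain ⟨n, m, hm⟩ := exists_gens C M
  obtain ⟨N, z, hz⟩ := exists_gens C (LinearMap.ker (coefMap (C := C) m))
  have hwd : ∀ g : Fin n → (D.P2 →ₗ[Cᵐᵒᵖ] C), ∑ j, mulMap (g j) (m j) = 0 →
      ∑ j, β (m j) (D.q (g j)) = 0 := fun g hg => by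
    obtain ⟨v, hv⟩ := sum_mulMap D.hP2 hz ((LinearMap.pi g).codRestrict _ (fun p => by
      rw [LinearMap.mem_ker, coefMap_apply]
      have := LinearMap.congr_fun hg p
      rw [LinearMap.sum_apply] at this
      exact this))
    have hgj : ∀ j, g j = ∑ l, ((z l : Fin n → C) j) • v l := fun j => by
      ext p
      have := congrArg (fun y : LinearMap.ker (coefMap (C := C) m) => (y : Fin n → C) j)
        (LinearMap.congr_fun hv p)
      simp only [LinearMap.sum_apply, mulMap_apply] at this
      rw [LinearMap.sum_apply]
      refine Eq.trans (show g j p = _ from this) ?_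
      rw [AddSubmonoidClass.coe_finsetSum, Finset.sum_apply]
      rfl
    have : ∀ j, β (m j) (D.q (g j)) =
        ∑ l, β (op ((z l : Fin n → C) j) • m j) (D.q (v l)) := fun j => by
      rw [hgj j, map_sum, h2s]
      exact Finset.sum_congr rfl fun l _ => by rw [map_smul, h4]
    rw [Finset.sum_congr rfl fun j _ => this j, Finset.sum_comm]
    refine Finset.sum_eq_zero fun l _ => ?_
    rw [← h1s]
    have := (z l).2
    rw [LinearMap.mem_ker, coefMap_apply] at this
    rw [this, h10]
  obtain ⟨H, hH⟩ := factor_surj (R := ℤ) (P := Fin n → (D.P2 →ₗ[Cᵐᵒᵖ] C))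
    (X := D.P2 →ₗ[Cᵐᵒᵖ] M) (Z := X)
    (AddMonoidHom.toIntLinearMap (AddMonoidHom.mk' (fun g => ∑ j, β (m j) (D.q (g j)))
      (fun g g' => by simp [h2, Finset.sum_add_distrib])))
    (AddMonoidHom.toIntLinearMap (AddMonoidHom.mk' (fun g => ∑ j, mulMap (g j) (m j))
      (fun g g' => by simp [mulMap_add_left, Finset.sum_add_distrib])))
    (fun u => by
      obtain ⟨g, hg⟩ := sum_mulMap D.hP2 hm u
      exact ⟨g, hg.symm⟩)
    hwd
  have hH' : ∀ g : Fin n → (D.P2 →ₗ[Cᵐᵒᵖ] C),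
    H (∑ j, mulMap (g j) (m j)) = ∑ j, β (m j) (D.q (g j)) := hH
  obtain ⟨h, hh'⟩ := h_of_H D w H.toAddMonoidHom (fun u' => by
      obtain ⟨g, rfl⟩ := sum_mulMap D.hP1 hm u'
      rw [sum_comp']
      refine (hH' fun j => (g j).comp D.d2).trans (Finset.sum_eq_zero fun j _ => ?_)
      rw [(D.hqk _).2 ⟨g j, rfl⟩, h20])
    (fun c f2 hf2 u => by
      obtain ⟨g, rfl⟩ := sum_mulMap D.hP2 hm u
      rw [sum_comp']
      refine (hH' fun j => (g j).comp f2).trans ?_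
      refine Eq.trans ?_ (congrArg (op c • ·) (hH' g).symm)
      show _ = op c • _
      rw [Finset.smul_sum]
      exact Finset.sum_congr rfl fun j _ => by rw [hf2, h3])
  have hH0 : ∀ u, H u = 0 := fun u => by
    obtain ⟨g, hg⟩ := zrel_right D w u
    have := hh' _ _ hg
    rw [hh h] at this
    exact this.symm
  intro x e
  obtain ⟨g, rfl⟩ := D.hq e
  obtain ⟨r, rfl⟩ := hm x
  rw [coefMap_apply, h1s, ← hH0 (∑ j, mulMap (r j • g) (m j)), hH']
  exact Finset.sum_congr rfl fun j _ => by rw [map_smul, h4]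


lemma finite_E (D : EData k C E) (hker : ∀ (n : ℕ) (α : (Fin n → Cᵐᵒᵖ) →ₗ[Cᵐᵒᵖ] Cᵐᵒᵖ),
      Module.Projective Cᵐᵒᵖ (LinearMap.ker α)) : Module.Finite Cᵐᵒᵖ E := by
  have := fd_op k C
  have : IsNoetherianRing Cᵐᵒᵖ := IsNoetherianRing.of_finite k Cᵐᵒᵖ
  have h1 : Module.Finite Cᵐᵒᵖ C := finite_reg k C
  have : Module.Finite Cᵐᵒᵖ (ModuleCat.of Cᵐᵒᵖ C) := h1
  obtain ⟨W, hW⟩ := exists_tauInvCosyz k (ModuleCat.of Cᵐᵒᵖ C)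
  obtain ⟨w⟩ := exists_wdata hker (ModuleCat.of Cᵐᵒᵖ C) W hW
  obtain ⟨h, hh⟩ := h_of_H D w (X := E) D.q.toAddMonoidHom (fun u' => (D.hqk _).2 ⟨u', rfl⟩)
    (fun c f2 hf2 u => hf2 u)
  have hsurj : Function.Surjective (h ∘ₗ w.q) := fun e => by
    obtain ⟨u, rfl⟩ := D.hq e
    obtain ⟨g, hg⟩ := zrel_right D w u
    exact ⟨g, hh _ _ hg⟩
  have := w.hQf
  obtain ⟨n, f, hf⟩ := Module.Finite.exists_fin' C w.Q1
  let ev : (w.Q1 →ₗ[C] C) →ₗ[Cᵐᵒᵖ] (Fin n → C) :=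
    { toFun := fun g i => g (f (Pi.single i 1)), map_add' := fun _ _ => rfl
      map_smul' := fun _ _ => rfl }
  have hev : Function.Injective ev := fun g g' hg => by
    have : g ∘ₗ f = g' ∘ₗ f := by
      refine LinearMap.pi_ext' fun i => LinearMap.ext_ring ?_
      exact congrFun hg i
    ext x
    obtain ⟨y, rfl⟩ := hf x
    exact LinearMap.congr_fun this y
  have : Module.Finite Cᵐᵒᵖ (w.Q1 →ₗ[C] C) := Module.Finite.of_injective ev hev
  exact Module.Finite.of_surjective _ hsurj

end Final

/-- For a tilted algebra `C` and its cluster-tilted algebra `B`, an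
indecomposable `τ_C`-rigid module `M` is `τ_B`-rigid iff
`Hom_C(τ⁻¹ Ω⁻¹ M, Gen M) = 0`. -/
theorem indecomposable_tauB_rigid_iff
    (k : Type) [Field k] (C : Type) [Ring C] [Algebra k C] [FiniteDimensional k C]
    (E : Type) [AddCommGroup E] [Module C E] [Module Cᵐᵒᵖ E] [SMulCommClass C Cᵐᵒᵖ E]
    [Module k E] [IsScalarTower k C E] [IsScalarTower k Cᵐᵒᵖ E]
    (A : Type) [Ring A] [Algebra k A] [FiniteDimensional k A]
    (hhered : ∀ N : Mdl Aᵐᵒᵖ, PdLE1 Aᵐᵒᵖ N)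
    (T : Mdl Aᵐᵒᵖ) [Module.Finite Aᵐᵒᵖ T] (hT : IsTilting Aᵐᵒᵖ T)
    (hC : Nonempty (C ≃+* Module.End Aᵐᵒᵖ T))
    (hE : IsRelExt k C E)
    (M : Mdl Cᵐᵒᵖ) [Module.Finite Cᵐᵒᵖ M]
    (hind : Indecomp Cᵐᵒᵖ M) (hrigid : TauRigid k C M) :
    TauRigid k (TrivSqZeroExt C E) (modB C E M) ↔
      ∀ W, IsTauInvCosyz k C M W →
        ∀ X, MemGen Cᵐᵒᵖ M X → HomZero Cᵐᵒᵖ W X := by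
  obtain ⟨ε⟩ := hC
  obtain ⟨D⟩ := exists_edata hE
  have := fd_op k C
  have : IsNoetherianRing Cᵐᵒᵖ := IsNoetherianRing.of_finite k Cᵐᵒᵖ
  have hker : ∀ (n : ℕ) (α : (Fin n → Cᵐᵒᵖ) →ₗ[Cᵐᵒᵖ] Cᵐᵒᵖ),
      Module.Projective Cᵐᵒᵖ (LinearMap.ker α) := fun n α =>
    tilt_ker_proj hhered T hT.1.2 ε α
  have : Module.Finite Cᵐᵒᵖ E := finite_E D hker
  have : FiniteDimensional k E := fd_of_finite k Cᵐᵒᵖ E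
  have : FiniteDimensional k (TrivSqZeroExt C E) :=
    inferInstanceAs (FiniteDimensional k (C × E))
  have : Module.Finite (TrivSqZeroExt C E)ᵐᵒᵖ (modB C E M) := by
    obtain ⟨S, hS⟩ := (inferInstance : Module.Finite Cᵐᵒᵖ M).1
    refine ⟨⟨S, ?_⟩⟩
    rw [eq_top_iff]
    rintro x' -
    obtain ⟨x, rfl⟩ : ∃ x : M, (show modB C E M from x) = x' := ⟨x', rfl⟩
    have hx : x ∈ Submodule.span Cᵐᵒᵖ (S : Set M) := hS ▸ trivial
    induction hx using Submodule.span_induction with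
    | mem x h => exact Submodule.subset_span h
    | zero => exact Submodule.zero_mem _
    | add x y _ _ h1 h2 => exact Submodule.add_mem _ h1 h2
    | smul c x _ h =>
      exact Submodule.smul_mem _ (op (TrivSqZeroExt.inl (unop c) : TrivSqZeroExt C E)) h
  rw [tauRigid_iff k (TrivSqZeroExt C E)]
  have hr := (tauRigid_iff k C M).1 hrigid
  constructor
  · intro h W hW X hX
    obtain ⟨w⟩ := exists_wdata hker M W hW
    exact hom_of_bal D w X (bal_of_ext M h X hX)
  · intro h
    obtain ⟨W, hW⟩ := exists_tauInvCosyz k M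
    obtain ⟨w⟩ := exists_wdata hker M W hW
    exact ext_of_bal M hr fun X hX => bal_of_hom D w X (h W hW X hX)
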